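/- arXiv:0902.1792 — 2 statements merged into one kernel-verified Lean document; each statement's English description precedes it below -/
import Mathlib

section
/- Let V be a finite ground set, let p_i ∈ [0,1] for each i ∈ V, and let f : 2^V → ℝ be a non-decreasing set function with f(∅) ≥ 0 that admits an (η,β)-cost-sharing scheme (with η ≥ 1, β ≥ 1). Then the correlation gap is bounded as L(f,V,{p_i}) ≤ η·β·(e/(e−1))·I(f,V,{p_i}). -/
open Finset

variable {W : Type*} [Fintype W] [DecidableEq W]

/-- Expected value of `f` under a distribution `α` on subsets of the ground set. -/
noncomputable def expVal (α : Finset W → ℝ) (f : Finset W → ℝ) : ℝ :=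
  ∑ S : Finset W, α S * f S

/-- `α` is a probability distribution on subsets of the ground set with marginals `p`. -/
def IsDistWithMarginals (p : W → ℝ) (α : Finset W → ℝ) : Prop :=
  (∀ S, 0 ≤ α S) ∧ (∑ S : Finset W, α S = 1) ∧
    (∀ i : W, ∑ S ∈ Finset.univ.filter (fun S => i ∈ S), α S = p i)

/-- The worst-case expected value `L(f,V,{p_i})`: supremum of the expected value of `f`
over all distributions with marginals `p`. -/
noncomputable def worstVal (p : W → ℝ) (f : Finset W → ℝ) : ℝ :=
  sSup {v | ∃ α, IsDistWithMarginals p α ∧ v = expVal α f}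

/-- The expected value `I(f,V,{p_i})` of `f` when each element is included
independently with probability `p i`. -/
noncomputable def indepVal (p : W → ℝ) (f : Finset W → ℝ) : ℝ :=
  ∑ S : Finset W, (∏ i ∈ S, p i) * (∏ i ∈ Sᶜ, (1 - p i)) * f S

/-- `χ` is an `(η,β)`-cost-sharing scheme for `f`.  An ordering of a subset `S` of the ground
set is encoded as a duplicate-free list `l` with `l.toFinset = S`; the restriction of the
ordering `l` to a subset `s` is `l.filter (· ∈ s)`.  The three conditions are:
`β`-budget balance, cross-monotonicity, and weak `η`-summability (the sum over `ℓ` of the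
share of the `ℓ`-th element in the set of the first `ℓ` elements is at most `η·f(S)`). -/
def IsCostShare (f : Finset W → ℝ) (η β : ℝ) (χ : List W → W → ℝ) : Prop :=
  (∀ l : List W, l ≠ [] → l.Nodup →
      ∑ i ∈ l.toFinset, χ l i ≤ f l.toFinset ∧ f l.toFinset / β ≤ ∑ i ∈ l.toFinset, χ l i) ∧
  (∀ l : List W, l.Nodup → ∀ s : Finset W, s ⊆ l.toFinset → ∀ i ∈ s,
      χ l i ≤ χ (l.filter (fun a => a ∈ s)) i) ∧
  (∀ l : List W, l ≠ [] → l.Nodup →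
      ∑ ℓ : Fin l.length, χ (l.take (ℓ.1 + 1)) (l.get ℓ) ≤ η * f l.toFinset)

lemma hasSum_pow_div_factorial_exp (t : ℝ) :
    HasSum (fun n : ℕ => t ^ n / (n.factorial : ℝ)) (Real.exp t) := by
  rw [Real.exp_eq_exp_ℝ]
  exact NormedSpace.expSeries_div_hasSum_exp t

lemma exp_le_cubic {r : ℝ} (h0 : 0 ≤ r) (h1 : r ≤ 1) :
    Real.exp r ≤ 1 + r + r ^ 2 / 2 + r ^ 3 * (Real.exp 1 - 5 / 2) := by
  have key : ∀ t : ℝ, HasSum (fun n : ℕ => t ^ (n + 3) / ((n + 3).factorial : ℝ))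
      (Real.exp t - (1 + t + t ^ 2 / 2)) := fun t => by
    have h := (hasSum_nat_add_iff' 3).2 (hasSum_pow_div_factorial_exp t)
    simpa [Finset.sum_range_succ] using h
  have h := hasSum_le (fun n => ?_) (key r) ((key 1).mul_left (r ^ 3))
  · linarith
  · rw [one_pow, mul_one_div, pow_add]
    gcongr
    exact mul_le_of_le_one_left (by positivity) (pow_le_one₀ h0 h1)

lemma mul_le_sq_mul_add_of_sq_le {k b m : ℝ} (hk : 0 < k) (h : b ^ 2 ≤ 4 * k * m) (r : ℝ) :
    b * r ≤ r ^ 2 * k + m := by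
  have h4 : 0 ≤ 4 * k * (r ^ 2 * k - b * r + m) := by
    linear_combination sq_nonneg (2 * k * r - b) + h
  have := nonneg_of_mul_nonneg_right h4 (by positivity)
  linarith

lemma rational_estimate_le_exp_neg {r c : ℝ} (hr0 : 0 ≤ r) (hr1 : r < 1) (hc0 : 0 < c)
    (hul : 0.36787 < Real.exp (-1)) :
    0.63213 * r ≤ r * (0.26424 * c) + r ^ 2 * (0.0803 * c) + Real.exp (-c) := by
  have hec := Real.exp_pos (-c)
  have hu_pos := Real.exp_pos (-1)
  rcases le_total c 1.4 with h14 | h14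
  · have ht : Real.exp (-1) * (2 - c) ≤ Real.exp (-c) := by
      have h1 := Real.add_one_le_exp (1 - c)
      have h2 : Real.exp (-c) = Real.exp (-1) * Real.exp (1 - c) := by
        rw [← Real.exp_add]; congr 1; ring
      rw [h2]
      exact mul_le_mul_of_nonneg_left (by linarith) hu_pos.le
    have ht' : 0.36787 * (2 - c) ≤ Real.exp (-c) := by nlinarith
    have hr' := sub_nonneg.2 hr1.le
    have h2 : 0 ≤ (1 - r) * (0.63213 - 0.42484 * c) := mul_nonneg hr' (by linarith)
    have h3 : 0 ≤ (1 - r) * (1 - r) * c := by positivity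
    nlinarith
  · rcases le_total 2.4 c with h24 | h24
    · have : 0 ≤ r ^ 2 * (0.0803 * c) := by positivity
      nlinarith
    · have ht : Real.exp (-1) * Real.exp (-1) * (3 - c) ≤ Real.exp (-c) := by
        have h1 := Real.add_one_le_exp (2 - c)
        have h2 : Real.exp (-c) = Real.exp (-1) * Real.exp (-1) * Real.exp (2 - c) := by
          rw [← Real.exp_add, ← Real.exp_add]; congr 1; ring
        rw [h2]
        exact mul_le_mul_of_nonneg_left (by linarith) (by positivity)
      have huu2 : 0.1353 ≤ Real.exp (-1) * Real.exp (-1) := by nlinarith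
      have ht' : 0.1353 * (3 - c) ≤ Real.exp (-c) := by nlinarith
      have hdisc : (0.63213 - 0.26424 * c) ^ 2 ≤ 4 * (0.0803 * c) * (0.1353 * (3 - c)) := by
        nlinarith [mul_nonneg (sub_nonneg.2 h14) (sub_nonneg.2 h24)]
      have := mul_le_sq_mul_add_of_sq_le (by positivity) hdisc r
      linarith

/-- The one-variable estimate combining the exponential growth of the cost shares with the
contribution of the empty set. -/
lemma mul_one_sub_exp_neg_div_add_exp_neg_ge {x c : ℝ} (hx : 0 < x) (hx1 : x ≤ 1) (hc : x ≤ c) :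
    (1 - Real.exp (-1)) * (c + (1 - x)) ≤ c * ((1 - Real.exp (-x)) / x) + Real.exp (-c) := by
  obtain ⟨r, rfl⟩ : ∃ r, x = 1 - r := ⟨1 - x, by ring⟩
  have hr0 : 0 ≤ r := by linarith
  have hr1 : r < 1 := by linarith
  have hu_pos := Real.exp_pos (-1)
  have heu : Real.exp 1 * Real.exp (-1) = 1 := by rw [← Real.exp_add]; simp
  have hru : Real.exp (-(1 - r)) = Real.exp r * Real.exp (-1) := by
    rw [← Real.exp_add]; congr 1; ring
  have hcub := exp_le_cubic hr0 hr1.le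
  have he1 := Real.exp_one_gt_d9
  have he2 := Real.exp_one_lt_d9
  set u := Real.exp (-1)
  have hul : 0.36787 < u := by nlinarith
  have huu : u < 0.36788 := by nlinarith
  have hg : (1 - u) + r * (1 - 2 * u) + r ^ 2 * (1 - 5 / 2 * u) ≤
      (1 - Real.exp (-(1 - r))) / (1 - r) := by
    rw [le_div_iff₀ hx, hru]
    have := mul_le_mul_of_nonneg_right hcub hu_pos.le
    have e3 : (1 + r + r ^ 2 / 2 + r ^ 3 * (Real.exp 1 - 5 / 2)) * u =
      (1 + r + r ^ 2 / 2 - r ^ 3 * (5 / 2)) * u + r ^ 3 * (Real.exp 1 * u) := by ring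
    rw [e3, heu] at this
    nlinarith
  have hc0 : 0 < c := by linarith
  have hmul := mul_le_mul_of_nonneg_left hg hc0.le
  suffices h : (1 - u) * r ≤ c * (r * (1 - 2 * u) + r ^ 2 * (1 - 5 / 2 * u)) + Real.exp (-c) by
    nlinarith
  have hA : r * (0.26424 * c) ≤ c * (r * (1 - 2 * u)) := by
    have : 0 ≤ r * c := by positivity
    nlinarith
  have hB : r ^ 2 * (0.0803 * c) ≤ c * (r ^ 2 * (1 - 5 / 2 * u)) := by
    have : 0 ≤ r ^ 2 * c := by positivity
    nlinarith
  have hC : (1 - u) * r ≤ 0.63213 * r := by nlinarith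
  linarith [rational_estimate_le_exp_neg hr0 hr1 hc0 hul]

/-- The step `h ↦ (S ↦ ∑ i, p i * h (insert i S))` adding one random element to a set. -/
noncomputable def insertOp (p : W → ℝ) : (Finset W → ℝ) →ₗ[ℝ] (Finset W → ℝ) where
  toFun h S := ∑ i, p i * h (insert i S)
  map_add' g h := by ext S; simp [mul_add, Finset.sum_add_distrib]
  map_smul' a h := by ext S; simp [Finset.mul_sum, mul_left_comm]

lemma insertOp_pow_succ_apply (p : W → ℝ) (n : ℕ) (h : Finset W → ℝ) (S : Finset W) :
    (insertOp p ^ (n + 1)) h S = ∑ i, p i * (insertOp p ^ n) h (insert i S) := by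
  rw [pow_succ']
  rfl

lemma insertOp_pow_subset_indicator (p : W → ℝ) (U : Finset W) (n : ℕ) (S : Finset W) :
    (insertOp p ^ n) (fun S => if S ⊆ U then (1 : ℝ) else 0) S =
      (∑ i ∈ U, p i) ^ n * if S ⊆ U then 1 else 0 := by
  induction n generalizing S with
  | zero => simp
  | succ n ih =>
    rw [insertOp_pow_succ_apply]
    simp only [ih, Finset.insert_subset_iff]
    by_cases hS : S ⊆ U
    · simp [hS, pow_succ', Finset.sum_mul, Finset.sum_ite_mem]
    · simp [hS]

lemma indepVal_subset_indicator (q : W → ℝ) (U : Finset W) :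
    indepVal q (fun S => if S ⊆ U then (1 : ℝ) else 0) = ∏ i ∈ Uᶜ, (1 - q i) := by
  have h := Finset.prod_add (fun i => if i ∈ U then q i else 0) (fun i => 1 - q i)
    (Finset.univ : Finset W)
  have h1 : ∏ i, ((if i ∈ U then q i else 0) + (1 - q i)) = ∏ i ∈ Uᶜ, (1 - q i) := by
    rw [← Finset.prod_subset (Finset.subset_univ Uᶜ)]
    · refine Finset.prod_congr rfl fun i hi => ?_
      simp [Finset.mem_compl.1 hi]
    · intro i _ hi
      simp [not_not.1 (mt Finset.mem_compl.2 hi)]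
  rw [← h1, h, indepVal, Finset.powerset_univ]
  refine Finset.sum_congr rfl fun S _ => ?_
  rw [← Finset.compl_eq_univ_sdiff]
  by_cases hS : S ⊆ U
  · have : ∏ i ∈ S, (if i ∈ U then q i else 0) = ∏ i ∈ S, q i :=
      Finset.prod_congr rfl fun i hi => by simp [hS hi]
    simp [hS, this]
  · obtain ⟨i, hi, hiU⟩ := Finset.not_subset.1 hS
    have h0 : ∏ i ∈ S, (if i ∈ U then q i else 0) = 0 :=
      Finset.prod_eq_zero hi (by simp [hiU])
    simp [hS, h0]

lemma indepVal_add (q : W → ℝ) (g h : Finset W → ℝ) :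
    indepVal q (g + h) = indepVal q g + indepVal q h := by
  simp [indepVal, mul_add, Finset.sum_add_distrib]

lemma indepVal_smul (q : W → ℝ) (a : ℝ) (h : Finset W → ℝ) :
    indepVal q (a • h) = a * indepVal q h := by
  simp [indepVal, Finset.mul_sum, mul_left_comm]

/-- A property of set functions that is linear and holds for all down-set indicators
`S ↦ [S ⊆ U]` holds for every set function. -/
lemma setFunction_mem_of_subset_indicator (M : Submodule ℝ (Finset W → ℝ))
    (hM : ∀ U : Finset W, (fun S => if S ⊆ U then (1 : ℝ) else 0) ∈ M) (h : Finset W → ℝ) :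
    h ∈ M := by
  have hsingle : ∀ T : Finset W, Pi.single T (1 : ℝ) ∈ M := by
    intro T
    induction T using Finset.strongInduction with
    | H T ih =>
      have : (Pi.single T (1 : ℝ) : Finset W → ℝ) =
          (fun S => if S ⊆ T then (1 : ℝ) else 0) - ∑ S ∈ T.ssubsets, Pi.single S (1 : ℝ) := by
        ext S
        simp only [Pi.sub_apply, Finset.sum_apply, Pi.single_apply]
        rw [Finset.sum_ite_eq]
        by_cases h1 : S = T
        · simp [h1]
        · simp [h1, Finset.ssubset_iff_subset_ne]
      rw [this]
      exact M.sub_mem (hM T) (M.sum_mem fun S hS => ih S (Finset.mem_ssubsets.1 hS))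
  have : h = ∑ T, h T • (Pi.single T (1 : ℝ) : Finset W → ℝ) := by
    ext S
    simp [Pi.single_apply]
  rw [this]
  exact M.sum_mem fun T _ => M.smul_mem _ (hsingle T)

/-- Poissonization: adding a Poisson number of random elements yields a product distribution. -/
lemma hasSum_insertOp_pow (p : W → ℝ) (h : Finset W → ℝ) :
    HasSum (fun n : ℕ => (insertOp p ^ n) h ∅ / (n.factorial : ℝ))
      (Real.exp (∑ i, p i) * indepVal (fun i => 1 - Real.exp (-p i)) h) := by
  let M : Submodule ℝ (Finset W → ℝ) :=
    { carrier := {h | HasSum (fun n : ℕ => (insertOp p ^ n) h ∅ / (n.factorial : ℝ))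
        (Real.exp (∑ i, p i) * indepVal (fun i => 1 - Real.exp (-p i)) h)}
      add_mem' := fun {g h} hg hh => by
        simpa [indepVal_add, mul_add, add_div] using HasSum.add hg hh
      zero_mem' := by simp [indepVal]
      smul_mem' := fun a h hh => by
        simpa [indepVal_smul, mul_left_comm, mul_div_assoc] using HasSum.mul_left a hh }
  refine setFunction_mem_of_subset_indicator M (fun U => ?_) h
  change HasSum _ _
  simp only [insertOp_pow_subset_indicator, indepVal_subset_indicator, sub_sub_cancel,
    Finset.empty_subset, if_true, mul_one]
  have hexp : Real.exp (∑ i, p i) * ∏ i ∈ Uᶜ, Real.exp (-p i) = Real.exp (∑ i ∈ U, p i) := by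
    rw [← Real.exp_sum, ← Real.exp_add, Finset.sum_neg_distrib,
      ← Finset.sum_add_sum_compl U p]
    congr 1; ring
  rw [hexp]
  exact hasSum_pow_div_factorial_exp _

lemma indepVal_eq_sum_erase (q : W → ℝ) (f : Finset W → ℝ) (i : W) :
    indepVal q f = ∑ S ∈ (Finset.univ.erase i).powerset,
      ((∏ j ∈ S, q j) * ∏ j ∈ (Finset.univ.erase i) \ S, (1 - q j)) *
        ((1 - q i) * f S + q i * f (insert i S)) := by
  have hu : (Finset.univ : Finset (Finset W)) =
      (insert i (Finset.univ.erase i)).powerset := by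
    rw [Finset.insert_erase (Finset.mem_univ i), Finset.powerset_univ]
  rw [indepVal, hu, Finset.sum_powerset_insert (Finset.notMem_erase i _),
    ← Finset.sum_add_distrib]
  refine Finset.sum_congr rfl fun S hS => ?_
  have hiS : i ∉ S := fun h => Finset.notMem_erase i _ (Finset.mem_powerset.1 hS h)
  have h1 : Sᶜ = insert i ((Finset.univ.erase i) \ S) := by
    ext j; by_cases hj : j = i <;> simp [hj, hiS]
  have h2 : (insert i S)ᶜ = (Finset.univ.erase i) \ S := by
    ext j; simp
  rw [h1, h2, Finset.prod_insert (by simp), Finset.prod_insert hiS]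
  ring

lemma indepVal_update_mono {q : W → ℝ} (hq : ∀ i, 0 ≤ q i ∧ q i ≤ 1) {f : Finset W → ℝ}
    (hmono : ∀ S T : Finset W, S ⊆ T → f S ≤ f T) (i : W) {t : ℝ} (ht : q i ≤ t) :
    indepVal q f ≤ indepVal (Function.update q i t) f := by
  rw [indepVal_eq_sum_erase q f i, indepVal_eq_sum_erase (Function.update q i t) f i]
  refine Finset.sum_le_sum fun S hS => ?_
  have hne : ∀ j ∈ S, j ≠ i := fun j hj => Finset.ne_of_mem_erase (Finset.mem_powerset.1 hS hj)
  have h1 : ∏ j ∈ S, Function.update q i t j = ∏ j ∈ S, q j :=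
    Finset.prod_congr rfl fun j hj => by simp [hne j hj]
  have h2 : ∏ j ∈ (Finset.univ.erase i) \ S, (1 - Function.update q i t j) =
      ∏ j ∈ (Finset.univ.erase i) \ S, (1 - q j) :=
    Finset.prod_congr rfl fun j hj => by
      simp [Finset.ne_of_mem_erase (Finset.mem_sdiff.1 hj).1]
  rw [h1, h2, Function.update_self]
  refine mul_le_mul_of_nonneg_left ?_ (mul_nonneg (Finset.prod_nonneg fun j _ => (hq j).1)
    (Finset.prod_nonneg fun j _ => sub_nonneg.2 (hq j).2))
  nlinarith [hmono S (insert i S) (Finset.subset_insert i S)]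

lemma indepVal_mono {q p : W → ℝ} (hq : ∀ i, 0 ≤ q i) (hqp : ∀ i, q i ≤ p i)
    (hp : ∀ i, p i ≤ 1) {f : Finset W → ℝ}
    (hmono : ∀ S T : Finset W, S ⊆ T → f S ≤ f T) :
    indepVal q f ≤ indepVal p f := by
  have key : ∀ s : Finset W, indepVal q f ≤ indepVal (s.piecewise p q) f := by
    intro s
    induction s using Finset.induction with
    | empty => simp
    | insert i s hi ih =>
      refine ih.trans ?_
      rw [Finset.piecewise_insert]
      refine indepVal_update_mono (fun j => ?_) hmono i ?_
      · by_cases hj : j ∈ s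
        · simpa [hj] using ⟨(hq j).trans (hqp j), hp j⟩
        · simpa [hj] using ⟨hq j, (hqp j).trans (hp j)⟩
      · simpa [hi] using hqp i
  simpa using key Finset.univ

lemma indepVal_const (q : W → ℝ) (a : ℝ) : indepVal q (fun _ => a) = a := by
  have h := indepVal_subset_indicator q (Finset.univ : Finset W)
  have h2 := indepVal_smul q a (fun S => if S ⊆ (Finset.univ : Finset W) then (1 : ℝ) else 0)
  rw [h] at h2
  simpa [Pi.smul_def] using h2

lemma apply_empty_le_indepVal {q : W → ℝ} (hq : ∀ i, 0 ≤ q i ∧ q i ≤ 1) {f : Finset W → ℝ}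
    (hmono : ∀ S T : Finset W, S ⊆ T → f S ≤ f T) : f ∅ ≤ indepVal q f := by
  rw [← indepVal_const q (f ∅)]
  refine Finset.sum_le_sum fun S _ => ?_
  exact mul_le_mul_of_nonneg_left (hmono _ _ (Finset.empty_subset S))
    (mul_nonneg (Finset.prod_nonneg fun j _ => (hq j).1)
      (Finset.prod_nonneg fun j _ => sub_nonneg.2 (hq j).2))

/-- The sum of the shares that the elements of the ordered set `l` pay upon their arrival. -/
noncomputable def arrivalCost (χ : List W → W → ℝ) (l : List W) : ℝ :=
  ∑ ℓ : Fin l.length, χ (l.take (ℓ.1 + 1)) (l.get ℓ)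

lemma arrivalCost_append_singleton {ι : Type*} (χ : List ι → ι → ℝ) (l : List ι) (i : ι) :
    arrivalCost χ (l ++ [i]) = arrivalCost χ l + χ (l ++ [i]) i := by
  have hlen : l.length + 1 = (l ++ [i]).length := by simp
  rw [arrivalCost, ← (finCongr hlen).sum_comp, Fin.sum_univ_castSucc, arrivalCost]
  congr 1
  · refine Finset.sum_congr rfl fun ℓ _ => ?_
    have h1 : (l ++ [i]).take (ℓ.1 + 1) = l.take (ℓ.1 + 1) :=
      List.take_append_of_le_length ℓ.2
    simp [h1]
  · have h1 : (l ++ [i]).take (l.length + 1) = l ++ [i] := List.take_of_length_le (by simp)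
    simp [h1]

lemma filter_mem_append_singleton {ι : Type*} [DecidableEq ι] {l r : List ι}
    (h : (l ++ r).Nodup) {i : ι} (hi : i ∈ r) :
    (l ++ r).filter (fun a => a ∈ (l ++ [i]).toFinset) = l ++ [i] := by
  rw [List.filter_append]
  have hd := List.disjoint_of_nodup_append h
  congr 1
  · rw [List.filter_eq_self]
    intro a ha
    simp [ha]
  · have : r.filter (fun a => a ∈ (l ++ [i]).toFinset) = r.filter (fun a => a = i) := by
      refine List.filter_congr fun a ha => ?_
      have : a ∉ l := fun h' => hd h' ha
      simp [this]
    rw [this, List.filter_eq, List.count_eq_one_of_mem (List.Nodup.of_append_right h) hi]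
    rfl

lemma IsCostShare.share_append_le {f : Finset W → ℝ} {η β : ℝ} {χ : List W → W → ℝ}
    (hχ : IsCostShare f η β χ) {l r : List W} (h : (l ++ r).Nodup) {i : W} (hi : i ∈ r) :
    χ (l ++ r) i ≤ χ (l ++ [i]) i := by
  have := hχ.2.1 (l ++ r) h (l ++ [i]).toFinset (fun a ha => by
    simp only [List.mem_toFinset, List.mem_append, List.mem_singleton] at ha ⊢
    rcases ha with ha | rfl
    exacts [Or.inl ha, Or.inr hi]) i (by simp)
  rwa [filter_mem_append_singleton h hi] at this

lemma IsCostShare.sum_share_le_arrivalCost {f : Finset W → ℝ} {η β : ℝ} {χ : List W → W → ℝ}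
    (hχ : IsCostShare f η β χ) (l r : List W) (h : (l ++ r).Nodup) :
    ∑ i ∈ l.toFinset, χ (l ++ r) i ≤ arrivalCost χ l := by
  induction l using List.reverseRecOn generalizing r with
  | nil => simp [arrivalCost]
  | append_singleton l i ih =>
    have h' : (l ++ ([i] ++ r)).Nodup := by rwa [← List.append_assoc]
    have hi : i ∉ l.toFinset := fun hl =>
      List.disjoint_of_nodup_append h' (List.mem_toFinset.1 hl) (by simp)
    have ht : (l ++ [i]).toFinset = insert i l.toFinset := by ext; simp
    rw [arrivalCost_append_singleton, ht, Finset.sum_insert hi, List.append_assoc]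
    linarith [ih _ h', hχ.share_append_le h' (i := i) (by simp)]

/-- The shares newly arriving elements of `A` would pay cover the value of `A`, up to what has
been paid on arrival so far. -/
lemma IsCostShare.le_sum_share_sdiff {f : Finset W → ℝ} {η β : ℝ} {χ : List W → W → ℝ}
    (hχ : IsCostShare f η β χ) (hβ : 0 < β)
    (hmono : ∀ S T : Finset W, S ⊆ T → f S ≤ f T) {l : List W} (hl : l.Nodup)
    {A : Finset W} (hA : A.Nonempty) :
    f A / β - arrivalCost χ l ≤ ∑ i ∈ A \ l.toFinset, χ (l ++ [i]) i := by
  set r := (A \ l.toFinset).toList with hr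
  have hmem : ∀ a, a ∈ r ↔ a ∈ A ∧ a ∉ l := fun a => by simp [hr]
  have hnd : (l ++ r).Nodup :=
    List.Nodup.append hl (Finset.nodup_toList _) fun a ha ha' => ((hmem a).1 ha').2 ha
  have hsub : A ⊆ (l ++ r).toFinset := fun a ha => by
    by_cases h : a ∈ l <;> simp [h, hmem, ha]
  have hne : l ++ r ≠ [] := by
    rintro h
    obtain ⟨a, ha⟩ := hA
    have := hsub ha
    simp [h] at this
  have hbb := (hχ.1 (l ++ r) hne hnd).2
  have hfA : f A / β ≤ f (l ++ r).toFinset / β :=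
    div_le_div_of_nonneg_right (hmono _ _ hsub) hβ.le
  have hsplit : (l ++ r).toFinset = l.toFinset ∪ A \ l.toFinset := by
    rw [List.toFinset_append, hr, Finset.toList_toFinset]
  have hsum : ∑ i ∈ (l ++ r).toFinset, χ (l ++ r) i =
      ∑ i ∈ l.toFinset, χ (l ++ r) i + ∑ i ∈ A \ l.toFinset, χ (l ++ r) i := by
    rw [hsplit, Finset.sum_union Finset.disjoint_sdiff]
  have h1 := hχ.sum_share_le_arrivalCost l r hnd
  have h2 : ∑ i ∈ A \ l.toFinset, χ (l ++ r) i ≤ ∑ i ∈ A \ l.toFinset, χ (l ++ [i]) i :=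
    Finset.sum_le_sum fun i hi => hχ.share_append_le hnd (Finset.mem_toList.2 hi)
  linarith

lemma IsDistWithMarginals.sum_mul_eq {p : W → ℝ} {α : Finset W → ℝ}
    (hα : IsDistWithMarginals p α) (s : Finset W) (g : W → ℝ) :
    ∑ i ∈ s, p i * g i = ∑ A, α A * ∑ i ∈ A ∩ s, g i := by
  have h : ∀ A : Finset W, α A * ∑ i ∈ A ∩ s, g i = ∑ i ∈ s, if i ∈ A then α A * g i else 0 := by
    intro A
    rw [Finset.mul_sum, ← Finset.sum_filter, Finset.inter_comm, ← Finset.filter_mem_eq_inter]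
  simp only [h]
  rw [Finset.sum_comm]
  refine Finset.sum_congr rfl fun i _ => ?_
  rw [← Finset.sum_filter, ← Finset.sum_mul, hα.2.2 i]

/-- Expected growth of the arrival cost when elements arrive at rates `p`. -/
lemma IsCostShare.le_sum_mul_share {f : Finset W → ℝ} {η β : ℝ} {χ : List W → W → ℝ}
    (hχ : IsCostShare f η β χ) (hβ : 0 < β)
    (hmono : ∀ S T : Finset W, S ⊆ T → f S ≤ f T) {p : W → ℝ} {α : Finset W → ℝ}
    (hα : IsDistWithMarginals p α) {l : List W} (hl : l.Nodup) :
    (expVal α f - α ∅ * f ∅) - (1 - α ∅) * (β * arrivalCost χ l) ≤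
      ∑ i ∈ l.toFinsetᶜ, p i * (β * χ (l ++ [i]) i) := by
  rw [hα.sum_mul_eq]
  have h1 : (expVal α f - α ∅ * f ∅) - (1 - α ∅) * (β * arrivalCost χ l) =
      ∑ A ∈ Finset.univ.erase ∅, α A * (f A - β * arrivalCost χ l) := by
    simp only [mul_sub, Finset.sum_sub_distrib, ← Finset.sum_mul]
    rw [expVal, ← hα.2.1, ← Finset.add_sum_erase _ _ (Finset.mem_univ (∅ : Finset W)),
      ← Finset.add_sum_erase _ α (Finset.mem_univ (∅ : Finset W))]
    ring
  rw [h1, ← Finset.add_sum_erase _ _ (Finset.mem_univ (∅ : Finset W))]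
  simp only [Finset.empty_inter, Finset.sum_empty, mul_zero, zero_add]
  refine Finset.sum_le_sum fun A hA => mul_le_mul_of_nonneg_left ?_ (hα.1 A)
  have h2 := hχ.le_sum_share_sdiff hβ hmono hl
    (Finset.nonempty_iff_ne_empty.2 (Finset.ne_of_mem_erase hA))
  rw [← Finset.mul_sum, ← Finset.sdiff_eq_inter_compl]
  have h3 := mul_le_mul_of_nonneg_left h2 hβ.le
  rwa [mul_sub, mul_div_cancel₀ _ hβ.ne'] at h3

lemma insertOp_pow_ge {p : W → ℝ} (hp : ∀ i, 0 ≤ p i) {F : Finset W → ℝ} {ψ : List W → ℝ}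
    {C x : ℝ} (hx : 0 ≤ x) (hxp : x ≤ ∑ i, p i)
    (hψ : ∀ l : List W, l.Nodup → ψ l ≤ F l.toFinset)
    (hdrift : ∀ l : List W, l.Nodup →
      C + ((∑ i, p i) - x) * ψ l ≤ ∑ i, p i * ψ (if i ∈ l then l else l ++ [i]))
    (n : ℕ) {l : List W} (hl : l.Nodup) :
    C * ((∑ i, p i) ^ n - ((∑ i, p i) - x) ^ n) + x * (((∑ i, p i) - x) ^ n * ψ l) ≤
      x * (insertOp p ^ n) F l.toFinset := by
  induction n generalizing l with
  | zero => simpa using mul_le_mul_of_nonneg_left (hψ l hl) hx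
  | succ n ih =>
    set lam := ∑ i, p i with hlam
    have hterm : ∀ i, p i * (C * (lam ^ n - (lam - x) ^ n)) +
        x * (lam - x) ^ n * (p i * ψ (if i ∈ l then l else l ++ [i])) ≤
        x * (p i * (insertOp p ^ n) F (insert i l.toFinset)) := by
      intro i
      have hnd : (if i ∈ l then l else l ++ [i]).Nodup := by
        split_ifs with h
        · exact hl
        · exact List.Nodup.append hl (List.nodup_singleton i) (by simpa using h)
      have hset : (if i ∈ l then l else l ++ [i]).toFinset = insert i l.toFinset := by
        split_ifs with h
        · simp [h]
        · ext; simp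
      have h := mul_le_mul_of_nonneg_left (ih hnd) (hp i)
      rw [hset] at h
      linarith
    have hsum := Finset.sum_le_sum fun i (_ : i ∈ Finset.univ) => hterm i
    rw [Finset.sum_add_distrib, ← Finset.sum_mul, ← Finset.mul_sum, ← Finset.mul_sum,
      ← insertOp_pow_succ_apply, ← hlam] at hsum
    have hd := mul_le_mul_of_nonneg_left (hdrift l hl)
      (mul_nonneg hx (pow_nonneg (sub_nonneg.2 hxp) n))
    refine le_trans (le_of_eq ?_) ((add_le_add_right hd _).trans hsum)
    ring

lemma exp_drift_le_indepVal {p : W → ℝ} (hp : ∀ i, 0 ≤ p i) {F : Finset W → ℝ}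
    {ψ : List W → ℝ} {C x : ℝ} (hx : 0 ≤ x) (hxp : x ≤ ∑ i, p i)
    (hψ : ∀ l : List W, l.Nodup → ψ l ≤ F l.toFinset)
    (hdrift : ∀ l : List W, l.Nodup →
      C + ((∑ i, p i) - x) * ψ l ≤ ∑ i, p i * ψ (if i ∈ l then l else l ++ [i])) :
    C * (1 - Real.exp (-x)) + x * (Real.exp (-x) * ψ [] +
        Real.exp (-∑ i, p i) * (F ∅ - ψ [])) ≤
      x * indepVal (fun i => 1 - Real.exp (-p i)) F := by
  set lam := ∑ i, p i with hlam
  have hs := hasSum_pow_div_factorial_exp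
  have hl := ((((hs lam).sub (hs (lam - x))).mul_left C).add
    ((hs (lam - x)).mul_left (x * ψ []))).add
    (hasSum_ite_eq (0 : ℕ) (x * (F ∅ - ψ [])))
  have hr := (hasSum_insertOp_pow p F).mul_left x
  have h := hasSum_le (fun n => ?_) hl hr
  · rw [← hlam] at h
    have e1 : Real.exp (lam - x) = Real.exp lam * Real.exp (-x) := by
      rw [← Real.exp_add]; congr 1
    have e2 : Real.exp lam * Real.exp (-lam) = 1 := by rw [← Real.exp_add]; simp
    refine le_of_mul_le_mul_left ?_ (Real.exp_pos lam)
    rw [e1] at h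
    linear_combination h + x * (F ∅ - ψ []) * e2
  · have hn := insertOp_pow_ge hp hx hxp hψ hdrift n List.nodup_nil
    rcases Nat.eq_zero_or_pos n with rfl | hpos
    · simp
      linarith
    · have hf : (0 : ℝ) < n.factorial := by exact_mod_cast n.factorial_pos
      simp only [hpos.ne', if_false, add_zero]
      rw [← sub_div, mul_div_assoc', mul_div_assoc', mul_div_assoc', ← add_div]
      refine div_le_div_of_nonneg_right ?_ hf.le
      simp only [List.toFinset_nil] at hn
      linarith

/-- Jensen's inequality for the weights `θ`, `a - θ` at `x`, `lam`. -/
lemma scaled_estimate {a x lam C θ : ℝ} (ha : 0 ≤ a) (hx : 0 < x) (hx1 : x ≤ 1)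
    (hC : a * x ≤ C) (hθ0 : 0 ≤ θ) (hθa : θ ≤ a)
    (hθ : a * lam - C ≤ θ * (lam - x)) :
    (1 - Real.exp (-1)) * (C + (1 - x) * a) ≤
      C * ((1 - Real.exp (-x)) / x) + (Real.exp (-x) * θ + Real.exp (-lam) * (a - θ)) := by
  rcases ha.eq_or_lt with rfl | ha
  · obtain rfl : θ = 0 := le_antisymm hθa hθ0
    have hC0 : 0 ≤ C := by simpa using hC
    have hg : 1 - Real.exp (-1) ≤ (1 - Real.exp (-x)) / x := by
      rw [le_div_iff₀ hx]
      have := convexOn_exp.2 (Set.mem_univ (-1)) (Set.mem_univ 0) hx.le (sub_nonneg.2 hx1)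
        (by ring)
      simp only [smul_eq_mul, mul_zero, add_zero, Real.exp_zero, mul_one, mul_neg_one] at this
      linarith
    nlinarith
  · have h1 := mul_one_sub_exp_neg_div_add_exp_neg_ge hx hx1 (c := C / a)
      (by rwa [le_div_iff₀ ha, mul_comm])
    have hJ := convexOn_exp.2 (Set.mem_univ (-x)) (Set.mem_univ (-lam))
      (div_nonneg hθ0 ha.le) (div_nonneg (sub_nonneg.2 hθa) ha.le)
      (by rw [← add_div, add_sub_cancel, div_self ha.ne'])
    simp only [smul_eq_mul] at hJ
    have harg : -(C / a) ≤ θ / a * -x + (a - θ) / a * -lam := by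
      have : θ / a * -x + (a - θ) / a * -lam - -(C / a) =
          (θ * (lam - x) - (a * lam - C)) / a := by ring
      have := div_nonneg (sub_nonneg.2 hθ) ha.le
      linarith
    have h2 := (Real.exp_le_exp.2 harg).trans hJ
    have h3 := mul_le_mul_of_nonneg_left (h1.trans (add_le_add_right h2 _)) ha.le
    have e1 : a * ((1 - Real.exp (-1)) * (C / a + (1 - x))) =
        (1 - Real.exp (-1)) * (C + (1 - x) * a) := by
      field_simp
    have e2 : a * (C / a * ((1 - Real.exp (-x)) / x) +
        (θ / a * Real.exp (-x) + (a - θ) / a * Real.exp (-lam))) =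
        C * ((1 - Real.exp (-x)) / x) + (Real.exp (-x) * θ + Real.exp (-lam) * (a - θ)) := by
      field_simp
    rwa [e1, e2] at h3

lemma IsCostShare.expVal_le {p : W → ℝ} (hp : ∀ i, 0 ≤ p i ∧ p i ≤ 1) {f : Finset W → ℝ}
    (hmono : ∀ S T : Finset W, S ⊆ T → f S ≤ f T) (hf0 : 0 ≤ f ∅) {η β : ℝ} (hη : 1 ≤ η)
    (hβ : 1 ≤ β) {χ : List W → W → ℝ} (hχ : IsCostShare f η β χ) {α : Finset W → ℝ}
    (hα : IsDistWithMarginals p α) :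
    (1 - Real.exp (-1)) * expVal α f ≤ η * β * indepVal p f := by
  have hβ0 : 0 < β := by linarith
  have hηβ : 1 ≤ η * β := one_le_mul_of_one_le_of_one_le hη hβ
  have hp0 : ∀ i, 0 ≤ p i := fun i => (hp i).1
  have hα1 : α ∅ ≤ 1 := by
    rw [← hα.2.1]
    exact Finset.single_le_sum (fun S _ => hα.1 S) (Finset.mem_univ _)
  have herase : ∑ A ∈ Finset.univ.erase ∅, α A = 1 - α ∅ := by
    rw [Finset.sum_erase_eq_sub (Finset.mem_univ _), hα.2.1]
  have hCsum : expVal α f - α ∅ * f ∅ = ∑ A ∈ Finset.univ.erase ∅, α A * f A := by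
    rw [Finset.sum_erase_eq_sub (Finset.mem_univ _), expVal]
  have hIf := apply_empty_le_indepVal hp hmono
  have hI0 : 0 ≤ indepVal p f := hf0.trans hIf
  set a := f ∅ with ha
  set C := expVal α f - α ∅ * a with hC
  obtain ⟨x, hx⟩ : ∃ x, x = 1 - α ∅ := ⟨_, rfl⟩
  have hαx : α ∅ = 1 - x := by linarith
  have hx0 : 0 ≤ x := by linarith
  have hx1 : x ≤ 1 := by linarith [hα.1 ∅]
  have hE : expVal α f = C + (1 - x) * a := by rw [hC, hαx]; ring
  have hCa : a * x ≤ C := by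
    rw [hCsum, hx, ← herase, Finset.mul_sum]
    refine Finset.sum_le_sum fun A _ => ?_
    rw [mul_comm]
    exact mul_le_mul_of_nonneg_left (hmono _ _ (Finset.empty_subset A)) (hα.1 A)
  have hlam_eq : ∑ i, p i = ∑ A, α A * (A.card : ℝ) := by
    simpa using hα.sum_mul_eq Finset.univ (fun _ => 1)
  have hxlam : x ≤ ∑ i, p i := by
    rw [hlam_eq, hx, ← herase]
    refine (Finset.sum_le_sum fun A hA => le_mul_of_one_le_right (hα.1 A) ?_).trans
      (Finset.sum_le_sum_of_subset_of_nonneg (f := fun A => α A * (A.card : ℝ))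
        (Finset.erase_subset ∅ Finset.univ)
        fun A _ _ => mul_nonneg (hα.1 A) (Nat.cast_nonneg _))
    exact_mod_cast Finset.card_pos.2
      (Finset.nonempty_iff_ne_empty.2 (Finset.ne_of_mem_erase hA))
  have hu1 : Real.exp (-1) ≤ 1 := by simp
  rcases hx0.eq_or_lt with hx00 | hxpos
  · have hC0 : C = 0 := by
      rw [hCsum]
      refine Finset.sum_eq_zero fun A hA => ?_
      rw [(Finset.sum_eq_zero_iff_of_nonneg fun B _ => hα.1 B).1
        (herase.trans (by linarith)) A hA, zero_mul]
    rw [hE, hC0, ← hx00]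
    have := Real.exp_pos (-1)
    nlinarith
  set lam := ∑ i, p i with hlam
  obtain ⟨θ, hθ0, hθa, hθ1, hθ2⟩ : ∃ θ, 0 ≤ θ ∧ θ ≤ a ∧ a * lam - C ≤ θ * (lam - x) ∧
      C + (lam - x) * θ ≤ max C (a * lam) := by
    rcases le_total (a * lam) C with h | h
    · exact ⟨0, le_rfl, hf0, by linarith, by simp⟩
    · rcases hxlam.eq_or_lt with h' | h'
      · exact ⟨0, le_rfl, hf0, by rw [← h']; linarith, by simp⟩
      · have hd : 0 < lam - x := sub_pos.2 h'
        refine ⟨(a * lam - C) / (lam - x), div_nonneg (sub_nonneg.2 h) hd.le, ?_, ?_, ?_⟩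
        · rw [div_le_iff₀ hd]; linarith
        · rw [div_mul_cancel₀ _ hd.ne']
        · rw [mul_div_cancel₀ _ hd.ne']
          exact le_max_of_le_right (by linarith)
  set ψ : List W → ℝ := fun l => if l = [] then θ else β * arrivalCost χ l with hψdef
  have hψ : ∀ l : List W, l.Nodup → ψ l ≤ ((η * β) • f) l.toFinset := by
    intro l hl
    by_cases h : l = []
    · simp only [hψdef, h, if_true, List.toFinset_nil, Pi.smul_apply, smul_eq_mul]
      exact hθa.trans (le_mul_of_one_le_left hf0 hηβ)
    · simp only [hψdef, h, if_false, Pi.smul_apply, smul_eq_mul]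
      calc β * arrivalCost χ l ≤ β * (η * f l.toFinset) :=
            mul_le_mul_of_nonneg_left (hχ.2.2 l h hl) hβ0.le
        _ = η * β * f l.toFinset := by ring
  have hdrift : ∀ l : List W, l.Nodup →
      C + (lam - x) * ψ l ≤ ∑ i, p i * ψ (if i ∈ l then l else l ++ [i]) := by
    intro l hl
    have hgrow := hχ.le_sum_mul_share hβ0 hmono hα hl
    rw [← ha, ← hC, ← hx] at hgrow
    by_cases h : l = []
    · subst h
      have e : ∑ i, p i * ψ (if i ∈ ([] : List W) then [] else [] ++ [i]) =
          ∑ i, p i * (β * χ [i] i) :=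
        Finset.sum_congr rfl fun i _ => by simp [hψdef, arrivalCost]
      have hψnil : ψ [] = θ := by simp [hψdef]
      rw [e, hψnil]
      refine hθ2.trans (max_le ?_ ?_)
      · simpa [arrivalCost] using hgrow
      · rw [hlam, Finset.mul_sum]
        refine Finset.sum_le_sum fun i _ => ?_
        rw [mul_comm]
        refine mul_le_mul_of_nonneg_left ?_ (hp0 i)
        have hb := (hχ.1 [i] (by simp) (by simp)).2
        simp only [List.toFinset_cons, List.toFinset_nil, insert_empty_eq,
          Finset.sum_singleton] at hb
        rw [div_le_iff₀ hβ0] at hb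
        linarith [hmono _ _ (Finset.empty_subset {i})]
    · have e : ∀ i, p i * ψ (if i ∈ l then l else l ++ [i]) =
          p i * (β * arrivalCost χ l) +
            if i ∈ l.toFinsetᶜ then p i * (β * χ (l ++ [i]) i) else 0 := by
        intro i
        by_cases hi : i ∈ l
        · simp [hψdef, hi, h]
        · simp [hψdef, hi, arrivalCost_append_singleton, mul_add]
      have hψl : ψ l = β * arrivalCost χ l := by simp [hψdef, h]
      rw [Finset.sum_congr rfl fun i _ => e i, Finset.sum_add_distrib, ← Finset.sum_mul,
        Finset.sum_ite_mem, Finset.univ_inter, hψl, ← hlam]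
      linarith
  have hmain := exp_drift_le_indepVal hp0 hx0 hxlam hψ hdrift
  have hψnil : ψ [] = θ := by simp [hψdef]
  rw [hψnil, indepVal_smul, ← hlam] at hmain
  have hest := scaled_estimate hf0 hxpos hx1 hCa hθ0 hθa hθ1
  have hq : indepVal (fun i => 1 - Real.exp (-p i)) f ≤ indepVal p f :=
    indepVal_mono (fun i => by simpa using hp0 i)
      (fun i => by linarith [Real.add_one_le_exp (-p i)]) (fun i => (hp i).2) hmono
  rw [← hE] at hest
  refine hest.trans (le_trans ?_ (mul_le_mul_of_nonneg_left hq (by linarith)))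
  refine le_of_mul_le_mul_left (le_trans ?_ hmain) hxpos
  have e : x * (C * ((1 - Real.exp (-x)) / x)) = C * (1 - Real.exp (-x)) := by
    field_simp
  rw [mul_add, e]
  have hFa : a ≤ ((η * β) • f) ∅ := le_mul_of_one_le_left hf0 hηβ
  gcongr

/-- Theorem 1: for a non-decreasing cost function with an `(η,β)`-cost-sharing scheme,
the correlation gap is bounded: `L ≤ η·β·(e/(e-1))·I`. -/
theorem correlation_gap_bound
    {V : Type*} [Fintype V] [DecidableEq V]
    (p : V → ℝ) (hp : ∀ i, 0 ≤ p i ∧ p i ≤ 1)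
    (f : Finset V → ℝ)
    (hmono : ∀ S T : Finset V, S ⊆ T → f S ≤ f T)
    (hf0 : 0 ≤ f ∅)
    (η β : ℝ) (hη : 1 ≤ η) (hβ : 1 ≤ β)
    (χ : List V → V → ℝ) (hχ : IsCostShare f η β χ) :
    worstVal p f ≤ η * β * (Real.exp 1 / (Real.exp 1 - 1)) * indepVal p f := by
  have he : 1 < Real.exp 1 := by simp
  have hi0 : 0 ≤ indepVal p f := hf0.trans (apply_empty_le_indepVal hp hmono)
  have hk : 0 ≤ Real.exp 1 / (Real.exp 1 - 1) :=
    div_nonneg (Real.exp_pos 1).le (by linarith)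
  refine Real.sSup_le ?_ (by positivity)
  rintro v ⟨α, hα, rfl⟩
  have h := mul_le_mul_of_nonneg_left (hχ.expVal_le hp hmono hf0 hη hβ hα) hk
  have hinv : Real.exp 1 / (Real.exp 1 - 1) * (1 - Real.exp (-1)) = 1 := by
    have : Real.exp 1 - 1 ≠ 0 := by linarith
    rw [Real.exp_neg]
    field_simp
  rw [← mul_assoc, hinv, one_mul] at h
  linarith
end

section
/- Let K be a positive integer, let V be a finite ground set, let f : 2^V → ℝ be non-decreasing with f(∅) ≥ 0 admitting an (η,β)-cost-sharing scheme, and let A_1, A_2, ..., A_K be a partition of V into K (possibly empty) parts. Let S be a random subset of V containing each element independently with probability 1/K. Then (1/K)·Σ_{k=1}^K f(A_k) ≤ η·β·(e/(e−1))·E[f(S)]. In particular, for instances (f,V,{1/K}) whose worst-case distribution is a K-partition-type distribution (each part A_k occurring with probability 1/K), the correlation gap L(f,V,{1/K})/I(f,V,{1/K}) is at most ηβ·e/(e−1). -/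
open Finset

variable {W : Type*} [Fintype W] [DecidableEq W]

/-- Expectation of `g` over the random sublist of `l` that keeps each entry independently
with probability `q`. -/
def sublistExp {V : Type*} (q : ℝ) : List V → (List V → ℝ) → ℝ
  | [], g => g []
  | a :: l, g => (1 - q) * sublistExp q l g + q * sublistExp q l (fun s => g (a :: s))

theorem sublistExp_mono {V : Type*} {q : ℝ} (h0 : 0 ≤ q) (h1 : q ≤ 1) (l : List V)
    (g h : List V → ℝ) (hgh : ∀ s, s.Sublist l → g s ≤ h s) :
    sublistExp q l g ≤ sublistExp q l h := by
  induction l generalizing g h with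
  | nil => exact hgh [] (List.Sublist.refl _)
  | cons a l ih =>
    have e1 := ih g h (fun s hs => hgh s (hs.cons a))
    have e2 := ih (fun s => g (a :: s)) (fun s => h (a :: s))
      (fun s hs => hgh (a :: s) (hs.cons_cons a))
    simp only [sublistExp]
    have := mul_le_mul_of_nonneg_left e1 (sub_nonneg.2 h1)
    have := mul_le_mul_of_nonneg_left e2 h0
    linarith

theorem sublistExp_affine {V : Type*} (q c d : ℝ) (l : List V) (g : List V → ℝ) :
    sublistExp q l (fun s => c * g s + d) = c * sublistExp q l g + d := by
  induction l generalizing g with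
  | nil => rfl
  | cons a l ih =>
    simp only [sublistExp]
    rw [ih g, ih (fun s => g (a :: s))]
    ring

theorem sublistExp_append {V : Type*} (q : ℝ) (l m : List V) (g : List V → ℝ) :
    sublistExp q (l ++ m) g
      = sublistExp q l (fun s => sublistExp q m (fun t => g (s ++ t))) := by
  induction l generalizing g with
  | nil => rfl
  | cons a l ih =>
    simp only [sublistExp, List.cons_append]
    rw [ih g, ih (fun s => g (a :: s))]

theorem sublistExp_toFinset {V : Type*} [DecidableEq V] (q : ℝ) (l : List V) (hl : l.Nodup)
    (g : Finset V → ℝ) :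
    sublistExp q l (fun s => g s.toFinset)
      = ∑ S ∈ l.toFinset.powerset, q ^ #S * (1 - q) ^ (#(l.toFinset \ S)) * g S := by
  induction l generalizing g with
  | nil => simp [sublistExp]
  | cons a l ih =>
    obtain ⟨ha, hl⟩ := List.nodup_cons.1 hl
    have ha' : a ∉ l.toFinset := by simpa using ha
    simp only [sublistExp, List.toFinset_cons]
    rw [Finset.sum_powerset_insert ha', ih hl g, ih hl (fun S => g (insert a S)),
      Finset.mul_sum, Finset.mul_sum]
    congr 1
    · refine Finset.sum_congr rfl fun S hS => ?_
      have hS' := Finset.mem_powerset.1 hS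
      have haS : a ∉ S := fun h => ha' (hS' h)
      rw [Finset.insert_sdiff_of_notMem _ haS, Finset.card_insert_of_notMem (by simp [ha'])]
      ring
    · refine Finset.sum_congr rfl fun S hS => ?_
      have hS' := Finset.mem_powerset.1 hS
      have haS : a ∉ S := fun h => ha' (hS' h)
      have : insert a l.toFinset \ insert a S = l.toFinset \ S := by
        ext x; simp only [mem_sdiff, mem_insert]
        by_cases hx : x = a
        · subst hx; simp [ha']
        · simp [hx]
      rw [this, Finset.card_insert_of_notMem haS]
      ring

theorem indepVal_const_s5 {V : Type*} [Fintype V] [DecidableEq V] (q : ℝ) (l : List V)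
    (hl : l.Nodup) (hu : l.toFinset = Finset.univ) (f : Finset V → ℝ) :
    indepVal (fun _ : V => q) f = sublistExp q l (fun s => f s.toFinset) := by
  rw [sublistExp_toFinset q l hl, hu, Finset.powerset_univ]
  simp [indepVal, Finset.compl_eq_univ_sdiff]

/-- Sum of the cost shares charged to the entries of the list at the moment they are appended,
one after another, to the first argument. -/
def incrementalCost {V : Type*} (χ : List V → V → ℝ) : List V → List V → ℝ
  | _, [] => 0
  | T, a :: s => χ (T ++ [a]) a + incrementalCost χ (T ++ [a]) s

theorem incrementalCost_eq_sum {V : Type*} (χ : List V → V → ℝ) (T s : List V) :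
    incrementalCost χ T s = ∑ ℓ : Fin s.length, χ (T ++ s.take (ℓ.1 + 1)) (s.get ℓ) := by
  induction s generalizing T with
  | nil => simp [incrementalCost]
  | cons a s ih =>
    simp only [incrementalCost, ih, List.length_cons]
    rw [Fin.sum_univ_succ]
    simp

theorem incrementalCost_append {V : Type*} (χ : List V → V → ℝ) (T s t : List V) :
    incrementalCost χ T (s ++ t)
      = incrementalCost χ T s + incrementalCost χ (T ++ s) t := by
  induction s generalizing T with
  | nil => simp [incrementalCost]
  | cons a s ih => simp [incrementalCost, ih, add_assoc]

theorem List.Sublist.filter_mem_toFinset {V : Type*} [DecidableEq V] {s l : List V}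
    (h : s.Sublist l) (hl : l.Nodup) : l.filter (fun a => a ∈ s.toFinset) = s := by
  induction h with
  | slnil => rfl
  | @cons s l a h ih =>
    obtain ⟨ha, hl⟩ := List.nodup_cons.1 hl
    have : a ∉ s := fun h' => ha (h.subset h')
    rw [List.filter_cons_of_neg (by simpa using this), ih hl]
  | @cons_cons s l a h ih =>
    obtain ⟨ha, hl⟩ := List.nodup_cons.1 hl
    rw [List.filter_cons_of_pos (by simp)]
    congr 1
    refine Eq.trans (List.filter_congr fun x hx => ?_) (ih hl)
    have : x ≠ a := fun h' => ha (h' ▸ hx)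
    simp [this]

namespace IsCostShare

variable {V : Type*} [DecidableEq V] {f : Finset V → ℝ} {η β q : ℝ} {χ : List V → V → ℝ}

theorem anti (h : IsCostShare f η β χ) {s l : List V} (hsl : s.Sublist l) (hl : l.Nodup) {i : V}
    (hi : i ∈ s) : χ l i ≤ χ s i := by
  have := h.2.1 l hl s.toFinset (fun x hx => by
    simpa using hsl.subset (by simpa using hx)) i (by simpa using hi)
  rwa [hsl.filter_mem_toFinset hl] at this

theorem div_le_sum (h : IsCostShare f η β χ) {l : List V} (hne : l ≠ []) (hl : l.Nodup) :
    f l.toFinset / β ≤ (l.map (χ l)).sum := by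
  have := (h.1 l hne hl).2
  rwa [List.sum_toFinset _ hl] at this

theorem sum_le_incrementalCost (h : IsCostShare f η β χ) {M : List V} (hM : M.Nodup)
    (T s : List V) (hs : (T ++ s).Sublist M) :
    (s.map (χ M)).sum ≤ incrementalCost χ T s := by
  induction s generalizing T with
  | nil => simp [incrementalCost]
  | cons a s ih =>
    have e : T ++ a :: s = (T ++ [a]) ++ s := by simp
    rw [e] at hs
    have h1 := ih (T ++ [a]) hs
    have h2 := h.anti ((List.sublist_append_left (T ++ [a]) s).trans hs) hM
      (i := a) (by simp)
    simp only [List.map_cons, List.sum_cons, incrementalCost]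
    linarith

theorem mul_sum_le_sublistExp (h : IsCostShare f η β χ) (h0 : 0 ≤ q) (h1 : q ≤ 1)
    {M : List V} (hM : M.Nodup) (T l : List V) (hs : (T ++ l).Sublist M) :
    q * (l.map (χ M)).sum ≤ sublistExp q l (incrementalCost χ T) := by
  induction l generalizing T with
  | nil => simp [incrementalCost, sublistExp]
  | cons a l ih =>
    have e : T ++ a :: l = (T ++ [a]) ++ l := by simp
    have i1 := ih T (((List.Sublist.refl T).append (List.sublist_cons_self a l)).trans hs)
    rw [e] at hs
    have i2 := ih (T ++ [a]) hs
    have i3 := h.anti ((List.sublist_append_left (T ++ [a]) l).trans hs) hM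
      (i := a) (by simp)
    have i4 := sublistExp_affine q 1 (χ (T ++ [a]) a) l (incrementalCost χ (T ++ [a]))
    have i5 : sublistExp q l (fun s => incrementalCost χ T (a :: s))
        = sublistExp q l (incrementalCost χ (T ++ [a])) + χ (T ++ [a]) a := by
      rw [← one_mul (sublistExp q l (incrementalCost χ (T ++ [a]))), ← i4]
      congr 1; funext s; simp only [incrementalCost]; ring
    simp only [List.map_cons, List.sum_cons, sublistExp]
    rw [i5]
    have := mul_le_mul_of_nonneg_left i1 (sub_nonneg.2 h1)
    have := mul_le_mul_of_nonneg_left (add_le_add i2 i3) h0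
    linarith

theorem add_mul_sum_le_sublistExp (h : IsCostShare f η β χ) (h0 : 0 ≤ q) (h1 : q ≤ 1)
    {M : List V} (hM : M.Nodup) (T l : List V) (hs : (T ++ l).Sublist M) :
    incrementalCost χ [] T + q * (l.map (χ M)).sum
      ≤ sublistExp q l (fun s => incrementalCost χ [] (T ++ s)) := by
  have i1 := h.mul_sum_le_sublistExp h0 h1 hM T l hs
  have i2 := sublistExp_affine q 1 (incrementalCost χ [] T) l (incrementalCost χ T)
  have i3 : sublistExp q l (fun s => incrementalCost χ [] (T ++ s))
      = sublistExp q l (incrementalCost χ T) + incrementalCost χ [] T := by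
    rw [← one_mul (sublistExp q l (incrementalCost χ T)), ← i2]
    congr 1; funext s; rw [incrementalCost_append, List.nil_append]; ring
  rw [i3]; linarith

theorem div_le_incrementalCost (h : IsCostShare f η β χ) {T : List V} (hne : T ≠ [])
    (hT : T.Nodup) : f T.toFinset / β ≤ incrementalCost χ [] T :=
  (h.div_le_sum hne hT).trans (h.sum_le_incrementalCost hT [] T (List.Sublist.refl _))

theorem incrementalCost_le (h : IsCostShare f η β χ) {T : List V} (hne : T ≠ [])
    (hT : T.Nodup) : incrementalCost χ [] T ≤ η * f T.toFinset := by
  rw [incrementalCost_eq_sum]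
  simpa using h.2.2 T hne hT

theorem sublistExp_incrementalCost_step (h : IsCostShare f η β χ)
    (hmono : ∀ S T : Finset V, S ⊆ T → f S ≤ f T) (hβ : 0 < β) (h0 : 0 ≤ q) (h1 : q ≤ 1)
    (T l : List V) (hl : l ≠ []) (hn : (T ++ l).Nodup) :
    (1 - q) * incrementalCost χ [] T + q * (f l.toFinset / β)
      ≤ sublistExp q l (fun s => incrementalCost χ [] (T ++ s)) := by
  have i1 := h.add_mul_sum_le_sublistExp h0 h1 hn T l (List.Sublist.refl _)
  have i2 := h.div_le_sum (l := T ++ l) (by simp [hl]) hn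
  have i3 := h.sum_le_incrementalCost hn [] T (by simp)
  rw [List.map_append, List.sum_append] at i2
  have i4 : f l.toFinset / β ≤ f (T ++ l).toFinset / β :=
    div_le_div_of_nonneg_right (hmono _ _ (by simp)) hβ.le
  have i5 : f l.toFinset / β - incrementalCost χ [] T ≤ (l.map (χ (T ++ l))).sum := by linarith
  have := mul_le_mul_of_nonneg_left i5 h0
  linarith

end IsCostShare

/-- `∑ j, q (1 - q) ^ (n - j) x j` for the list `x 1, …, x n`. -/
def discountedSum (q : ℝ) : List ℝ → ℝ
  | [] => 0
  | x :: L => q * (1 - q) ^ L.length * x + discountedSum q L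

namespace IsCostShare

variable {V : Type*} [DecidableEq V] {f : Finset V → ℝ} {η β q : ℝ} {χ : List V → V → ℝ}

theorem discountedSum_le_sublistExp (h : IsCostShare f η β χ)
    (hmono : ∀ S T : Finset V, S ⊆ T → f S ≤ f T) (hβ : 0 < β) (h0 : 0 ≤ q) (h1 : q ≤ 1)
    (L : List (List V)) (hL : ∀ l ∈ L, l ≠ []) (T : List V) (hn : (T ++ L.flatten).Nodup) :
    (1 - q) ^ L.length * incrementalCost χ [] T
        + discountedSum q (L.map fun l => f l.toFinset / β)
      ≤ sublistExp q L.flatten (fun s => incrementalCost χ [] (T ++ s)) := by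
  induction L generalizing T with
  | nil => simp [sublistExp, discountedSum]
  | cons l L ih =>
    have hn' : ((T ++ l) ++ L.flatten).Nodup := by simpa using hn
    have hpow : 0 ≤ (1 - q) ^ L.length := pow_nonneg (by linarith) _
    have step := h.sublistExp_incrementalCost_step hmono hβ h0 h1 T l (hL l (by simp))
      (List.Nodup.of_append_left hn')
    have := mul_le_mul_of_nonneg_left step hpow
    rw [List.flatten_cons, sublistExp_append]
    refine le_trans ?_ (sublistExp_mono h0 h1 l
      (fun s => (1 - q) ^ L.length * incrementalCost χ [] (T ++ s)
        + discountedSum q (L.map fun l => f l.toFinset / β)) _ fun s hs => ?_)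
    · rw [sublistExp_affine q _ _ l (fun s => incrementalCost χ [] (T ++ s))]
      simp only [List.length_cons, List.map_cons, discountedSum, List.length_map]
      rw [pow_succ]
      linarith
    · simpa using ih (fun l hl => hL l (by simp [hl])) (T ++ s)
        (hn'.sublist (((List.Sublist.refl T).append hs).append (List.Sublist.refl _)))

end IsCostShare

/-- The largest sum of `w` over a suffix of the list, the empty suffix included. -/
def maxSuffixSum {V : Type*} (w : V → ℝ) : List V → ℝ
  | [] => 0
  | a :: l => max (maxSuffixSum w l) (w a + (l.map w).sum)

theorem maxSuffixSum_nonneg {V : Type*} (w : V → ℝ) (l : List V) : 0 ≤ maxSuffixSum w l := by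
  induction l with
  | nil => exact le_refl _
  | cons a l ih => exact ih.trans (le_max_left _ _)

theorem sum_le_maxSuffixSum {V : Type*} (w : V → ℝ) (l : List V) :
    (l.map w).sum ≤ maxSuffixSum w l := by
  cases l with
  | nil => simp [maxSuffixSum]
  | cons a l => simp [maxSuffixSum]

theorem rpow_sub_self_le {q d : ℝ} (h1 : q < 1) (hd : 0 ≤ d) (hd1 : d ≤ 1) :
    (1 - q) ^ d - (1 - q) ≤ q * (1 - d) := by
  have := rpow_one_add_le_one_add_mul_self (s := -q) (by linarith) hd hd1
  rw [← sub_eq_add_neg] at this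
  linarith

theorem first_hit_inequality {q D R G x y v c : ℝ} (h0 : 0 < q) (h1 : q < 1)
    (hx : 0 ≤ x) (hy : y ≤ x) (hD0 : 0 ≤ D) (hD : (1 - q) ^ G ≤ D) {N₁ N₂ : ℝ}
    (hN₁ : D * (q * x) + R + (1 - q) ^ (x + G) ≤ N₁)
    (hv1 : 1 + q * x ≤ v) (hv2 : c + q * y ≤ v) (hN₂ : D * v + R ≤ N₂) :
    D * (q * max x (c + y)) + R + (1 - q) ^ (max x (c + y) + G) ≤ (1 - q) * N₁ + q * N₂ := by
  have ht : 0 < 1 - q := by linarith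
  obtain ⟨d, hd⟩ : ∃ d, d = max x (c + y) - x := ⟨_, rfl⟩
  have hd0 : 0 ≤ d := by rw [hd]; linarith [le_max_left x (c + y)]
  have hmax : max x (c + y) = x + d := by rw [hd]; ring
  rw [hmax]
  have hY : (1 - q) ^ (x + G) ≤ D := by
    refine le_trans ?_ hD
    exact Real.rpow_le_rpow_of_exponent_ge ht (by linarith) (by linarith)
  have hY0 : 0 ≤ (1 - q) ^ (x + G) := (Real.rpow_pos_of_pos ht _).le
  have hv : max 1 d + q * x ≤ v := by
    rcases max_choice 1 d with h | h
    · rw [h]; exact hv1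
    · rw [h]
      rcases le_total (c + y) x with hc | hc
      · have : d = 0 := by rw [hd, max_eq_left hc]; ring
        rw [this]; linarith
      · rw [hd, max_eq_right hc]
        have := mul_nonneg ht.le (sub_nonneg.2 hy)
        linarith
  have e : (1 - q) ^ (x + d + G) = (1 - q) ^ (x + G) * (1 - q) ^ d := by
    rw [← Real.rpow_add ht]; ring_nf
  rw [e]
  have k1 := mul_le_mul_of_nonneg_left hN₁ ht.le
  have k2 := mul_le_mul_of_nonneg_left hN₂ h0.le
  have k3 := mul_le_mul_of_nonneg_left (mul_le_mul_of_nonneg_left hv hD0) h0.le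
  have key : (1 - q) ^ (x + G) * ((1 - q) ^ d - (1 - q)) ≤ D * (q * (max 1 d - d)) := by
    rcases le_total d 1 with h | h
    · rw [max_eq_left h]
      refine (mul_le_mul_of_nonneg_left (rpow_sub_self_le h1 hd0 h) hY0).trans ?_
      exact mul_le_mul_of_nonneg_right hY (mul_nonneg h0.le (sub_nonneg.2 h))
    · rw [max_eq_right h]
      have : (1 - q) ^ d ≤ (1 - q) ^ (1 : ℝ) :=
        Real.rpow_le_rpow_of_exponent_ge ht (by linarith) h
      rw [Real.rpow_one] at this
      have := mul_nonneg hY0 (sub_nonneg.2 this)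
      linarith
  linarith

theorem add_rpow_mono {q D G x y : ℝ} (h0 : 0 < q) (h1 : q < 1) (hx : 1 ≤ x) (hxy : x ≤ y)
    (hD : (1 - q) ^ G ≤ D) :
    D * (q * x) + (1 - q) ^ (x + G) ≤ D * (q * y) + (1 - q) ^ (y + G) := by
  have ht : 0 < 1 - q := by linarith
  obtain ⟨d, rfl⟩ : ∃ d, y = x + d := ⟨y - x, by ring⟩
  have hd : 0 ≤ d := by linarith
  have e : (1 - q) ^ (x + d + G) = (1 - q) ^ x * (1 - q) ^ G * (1 - q) ^ d := by
    rw [← Real.rpow_add ht, ← Real.rpow_add ht]; ring_nf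
  have e' : (1 - q) ^ (x + G) = (1 - q) ^ x * (1 - q) ^ G := Real.rpow_add ht _ _
  have hxt : (1 - q) ^ x ≤ 1 - q := by
    simpa using Real.rpow_le_rpow_of_exponent_ge ht (by linarith) hx
  have hG : 0 < (1 - q) ^ G := Real.rpow_pos_of_pos ht _
  have hdd : (1 - q) * (1 - (1 - q) ^ d) ≤ q * d := by
    have a1 := Real.one_sub_inv_le_log_of_pos ht
    have a2 := Real.add_one_le_exp (Real.log (1 - q) * d)
    rw [← Real.rpow_def_of_pos ht] at a2
    have a3 := mul_le_mul_of_nonneg_left a1 (mul_nonneg ht.le hd)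
    have a4 : (1 - q) * d * (1 - (1 - q)⁻¹) = (1 - q) * d - d := by field_simp
    have a5 := mul_le_mul_of_nonneg_left a2 ht.le
    nlinarith
  have hd1 : 0 ≤ 1 - (1 - q) ^ d := by
    have := Real.rpow_le_one ht.le (by linarith : 1 - q ≤ 1) hd
    linarith
  rw [e, e']
  have b1 : (1 - q) ^ x * (1 - (1 - q) ^ d) ≤ q * d :=
    (mul_le_mul_of_nonneg_right hxt hd1).trans hdd
  have b2 := mul_le_mul_of_nonneg_left b1 hG.le
  have b3 := mul_le_mul_of_nonneg_right hD (mul_nonneg h0.le hd)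
  linarith

namespace IsCostShare

variable {V : Type*} [DecidableEq V] {f : Finset V → ℝ} {η β q : ℝ} {χ : List V → V → ℝ}

theorem one_add_maxSuffixSum_le_sublistExp (h : IsCostShare f η β χ)
    (hone : ∀ S, 1 ≤ f S / β) (h0 : 0 ≤ q) (h1 : q ≤ 1) {M : List V} (hM : M.Nodup)
    (T l : List V) (hT : T ≠ []) (hs : (T ++ l).Sublist M) :
    1 + q * maxSuffixSum (χ M) l
      ≤ sublistExp q l (fun s => incrementalCost χ [] (T ++ s)) := by
  have hT1 (T' l' : List V) (hT' : T' ≠ []) (hs' : (T' ++ l').Sublist M) :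
      1 ≤ incrementalCost χ [] T' :=
    (hone _).trans (h.div_le_incrementalCost hT'
      (hM.sublist ((List.sublist_append_left T' l').trans hs')))
  induction l generalizing T with
  | nil => simpa [maxSuffixSum, sublistExp] using hT1 T [] hT hs
  | cons a l ih =>
    have e : T ++ a :: l = (T ++ [a]) ++ l := by simp
    have k := h.add_mul_sum_le_sublistExp h0 h1 hM T (a :: l) hs
    have k1 := hT1 T (a :: l) hT hs
    have i1 := ih T hT (((List.Sublist.refl T).append (List.sublist_cons_self a l)).trans hs)
    rw [e] at hs
    have i2 := ih (T ++ [a]) (by simp) hs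
    simp only [maxSuffixSum]
    rcases max_choice (maxSuffixSum (χ M) l) (χ M a + (l.map (χ M)).sum) with hm | hm
    · rw [hm]
      simp only [sublistExp]
      simp only [List.append_assoc, List.singleton_append] at i2
      have := mul_le_mul_of_nonneg_left i1 (sub_nonneg.2 h1)
      have := mul_le_mul_of_nonneg_left i2 h0
      linarith
    · rw [hm]
      rw [List.map_cons, List.sum_cons] at k
      linarith

/-- The lower bound of `discountedSum_le_sublistExp` when the empty list is charged `1` instead
of `0`. -/
theorem discountedSum_add_rpow_le_sublistExp (h : IsCostShare f η β χ)
    (hmono : ∀ S T : Finset V, S ⊆ T → f S ≤ f T) (hβ : 0 < β) (hone : ∀ S, 1 ≤ f S / β)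
    (h0 : 0 < q) (h1 : q < 1) (L : List (List V)) (hL : ∀ l ∈ L, l ≠ [])
    (hn : L.flatten.Nodup) :
    discountedSum q (L.map fun l => f l.toFinset / β)
        + (1 - q) ^ (L.map fun l => f l.toFinset / β).sum
      ≤ sublistExp q L.flatten (fun s => if s = [] then 1 else incrementalCost χ [] s) := by
  induction L with
  | nil => simp [sublistExp, discountedSum]
  | cons P L ih =>
    have hL' : ∀ l ∈ L, l ≠ [] := fun l hl => hL l (by simp [hl])
    have hn' : (P ++ L.flatten).Nodup := by simpa using hn
    have hP : P.Nodup := hn'.of_append_left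
    have base := ih hL' hn'.of_append_right
    set G := (L.map fun l => f l.toFinset / β).sum with hG
    set R := discountedSum q (L.map fun l => f l.toFinset / β) with hR
    have ht : 0 < 1 - q := by linarith
    have hD0 : 0 ≤ (1 - q) ^ L.length := pow_nonneg ht.le _
    have hlen : (L.length : ℝ) ≤ G := by
      have := List.card_nsmul_le_sum (L.map fun l => f l.toFinset / β) 1 (by
        intro x hx
        obtain ⟨l, _, rfl⟩ := List.mem_map.1 hx
        exact hone _)
      simpa using this
    have hD : (1 - q) ^ G ≤ (1 - q) ^ L.length := by
      rw [← Real.rpow_natCast]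
      exact Real.rpow_le_rpow_of_exponent_ge ht (by linarith) hlen
    have inner : ∀ l : List V, l.Sublist P →
        (1 - q) ^ L.length * (q * maxSuffixSum (χ P) l) + R
            + (1 - q) ^ (maxSuffixSum (χ P) l + G)
          ≤ sublistExp q (l ++ L.flatten)
              (fun s => if s = [] then 1 else incrementalCost χ [] s) := by
      intro l
      induction l with
      | nil => intro _; simpa [maxSuffixSum] using base
      | cons a l ihl =>
        intro hl
        have hl' : l.Sublist P := (List.sublist_cons_self a l).trans hl
        have hnl : (a :: l ++ L.flatten).Nodup := hn'.sublist (hl.append (List.Sublist.refl _))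
        simp only [List.cons_append, sublistExp]
        have v1 := h.one_add_maxSuffixSum_le_sublistExp hone h0.le h1.le hP [a] l (by simp)
          (by simpa using hl)
        have v2 := h.add_mul_sum_le_sublistExp h0.le h1.le hP [a] l (by simpa using hl)
        have v3 : χ P a ≤ incrementalCost χ [] [a] := by
          simpa [incrementalCost] using h.anti (s := [a])
            ((List.singleton_sublist.2 (by simp)).trans hl) hP (i := a) (by simp)
        refine first_hit_inequality h0 h1 (maxSuffixSum_nonneg _ _) (sum_le_maxSuffixSum _ _)
          hD0 hD (ihl hl') v1 (by linarith) ?_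
        rw [← sublistExp_affine, sublistExp_append]
        refine sublistExp_mono h0.le h1.le _ _ _ fun s hs => ?_
        simpa using h.discountedSum_le_sublistExp hmono hβ h0.le h1.le L hL' (a :: s)
          (hnl.sublist ((hs.cons_cons a).append (List.Sublist.refl _)))
    have hPF : f P.toFinset / β ≤ maxSuffixSum (χ P) P :=
      (h.div_le_sum (hL P (by simp)) hP).trans (sum_le_maxSuffixSum _ _)
    have k1 := add_rpow_mono h0 h1 (hone P.toFinset) hPF hD
    have k2 := inner P (List.Sublist.refl _)
    simp only [List.flatten_cons, List.map_cons, List.sum_cons, discountedSum, List.length_map]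
    rw [← hG, ← hR]
    linarith

end IsCostShare

theorem card_mul_discountedSum_ge {q : ℝ} (h0 : 0 ≤ q) (h1 : q ≤ 1) (L : List ℝ)
    (hL : L.Pairwise (· ≤ ·)) :
    (1 - (1 - q) ^ L.length) * L.sum ≤ L.length * discountedSum q L := by
  induction L with
  | nil => simp
  | cons x L ih =>
    obtain ⟨hx, hL⟩ := List.pairwise_cons.1 hL
    have ih := ih hL
    rcases eq_or_ne L [] with rfl | hne
    · simp [discountedSum]
    have hn : 0 < (L.length : ℝ) := by exact_mod_cast List.length_pos_iff.2 hne
    have hs : L.length * x ≤ L.sum := by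
      simpa using List.card_nsmul_le_sum L x hx
    have hq : L.length * (q * (1 - q) ^ L.length) ≤ 1 - (1 - q) ^ L.length := by
      clear * - h0 h1
      induction L.length with
      | zero => simp
      | succ n ih =>
        have hp : 0 ≤ (1 - q) ^ n := pow_nonneg (by linarith) _
        push_cast
        rw [pow_succ]
        have : (1 - q) * (n * (q * (1 - q) ^ n)) ≤ 1 * (n * (q * (1 - q) ^ n)) :=
          mul_le_mul_of_nonneg_right (by linarith) (by positivity)
        nlinarith [mul_nonneg (mul_nonneg h0 h0) hp]
    simp only [List.length_cons, List.sum_cons, discountedSum]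
    push_cast
    set t := (1 - q) ^ L.length
    have ht : (1 - q) ^ (L.length + 1) = t * (1 - q) := pow_succ _ _
    rw [ht]
    set n := (L.length : ℝ)
    have k := mul_nonneg (sub_nonneg.2 hs) (sub_nonneg.2 hq)
    have k2 := mul_le_mul_of_nonneg_left ih (by linarith : 0 ≤ n + 1)
    refine le_of_mul_le_mul_left ?_ hn
    nlinarith

theorem exp_neg_le_of_le_half {y : ℝ} (h0 : 0 ≤ y) (h1 : y ≤ 1 / 2) :
    y * (1 - Real.exp (-1) + 0.302 * (1 - y)) ≤ 1 - Real.exp (-y) := by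
  have he : 0.3678 < Real.exp (-1) := by
    rw [Real.exp_neg, lt_inv_comm₀ (by norm_num) (Real.exp_pos 1)]
    exact Real.exp_one_lt_d9.trans (by norm_num)
  have hb := (abs_le.1 (Real.exp_bound (x := -y) (by rw [abs_neg, abs_of_nonneg h0]; linarith)
    (n := 4) (by norm_num))).2
  rw [abs_neg, abs_of_nonneg h0] at hb
  simp [Finset.sum_range_succ, Nat.factorial] at hb
  have key : 0 ≤ 0.0658 - 0.198 * y + y ^ 2 / 6 - 5 / 96 * y ^ 3 := by
    nlinarith [mul_nonneg (mul_nonneg h0 h0) (sub_nonneg.2 h1), sq_nonneg (y - 1 / 2)]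
  have := mul_nonneg h0 key
  have := mul_le_mul_of_nonneg_left he.le h0
  nlinarith

theorem exp_neg_le_of_half_le {y : ℝ} (h0 : 1 / 2 ≤ y) (h1 : y ≤ 1) :
    y * (1 - Real.exp (-1) + 0.25 * (1 - y)) ≤ 1 - Real.exp (-y) := by
  have he : Real.exp (-1) < 0.3679 := by
    rw [Real.exp_neg, inv_lt_comm₀ (Real.exp_pos 1) (by norm_num)]
    exact lt_trans (by norm_num) Real.exp_one_gt_d9
  obtain ⟨z, rfl⟩ : ∃ z, y = 1 - z := ⟨1 - y, by ring⟩
  have hz : 0 ≤ z := by linarith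
  have hb := Real.exp_bound' hz (by linarith) (n := 3) (by norm_num)
  simp [Finset.sum_range_succ, Nat.factorial] at hb
  have e : Real.exp (-(1 - z)) = Real.exp (-1) * Real.exp z := by
    rw [← Real.exp_add]; ring_nf
  rw [e]
  have hb' : Real.exp z ≤ 1 + z + 0.612 * z ^ 2 := by
    nlinarith [mul_nonneg (mul_nonneg hz hz) (by linarith : 0 ≤ 1 / 2 - z)]
  have k1 := mul_le_mul_of_nonneg_left hb' (Real.exp_pos (-1)).le
  have k2 := mul_le_mul_of_nonneg_right he.le (by positivity : 0 ≤ 2 * z + 0.612 * z ^ 2)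
  nlinarith

theorem exp_neg_partition_inequality {x y : ℝ} (hx : 0 ≤ x) (hy : 0 < y) (hy1 : y ≤ 1) :
    (1 - Real.exp (-1)) * (x + (1 - y))
      ≤ (1 - Real.exp (-y)) * (x / y) + Real.exp (-x) := by
  have he : 0.3678 < Real.exp (-1) := by
    rw [Real.exp_neg, lt_inv_comm₀ (by norm_num) (Real.exp_pos 1)]
    exact Real.exp_one_lt_d9.trans (by norm_num)
  have he' : Real.exp (-1) < 0.3679 := by
    rw [Real.exp_neg, inv_lt_comm₀ (Real.exp_pos 1) (by norm_num)]
    exact lt_trans (by norm_num) Real.exp_one_gt_d9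
  have hxy : 0 ≤ x / y := by positivity
  have exy : y * (x / y) = x := by field_simp
  have tangent (b : ℝ) : Real.exp (-b) * (1 + b - x) ≤ Real.exp (-x) := by
    have := mul_le_mul_of_nonneg_left (Real.add_one_le_exp (b - x)) (Real.exp_pos (-b)).le
    rw [← Real.exp_add] at this
    have e : -b + (b - x) = -x := by ring
    rw [e] at this
    linarith
  have hE := Real.exp_pos (-x)
  have e2 : Real.exp (-2) = Real.exp (-1) * Real.exp (-1) := by
    rw [← Real.exp_add]; norm_num
  have he2 : 0.135 ≤ Real.exp (-2) := by rw [e2]; nlinarith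
  have he2' : Real.exp (-2) ≤ 0.136 := by rw [e2]; nlinarith
  rcases le_total y (1 / 2) with h | h
  · have k1 := mul_le_mul_of_nonneg_right (exp_neg_le_of_le_half hy.le h) hxy
    have k2 : 0.302 * x + Real.exp (-x) ≥ 0.6322 := by
      rcases le_total x 1.5 with hx' | hx'
      · nlinarith [tangent 1]
      · nlinarith [tangent 2]
    have k3 : 0 ≤ (1 - y) * (0.302 * x + Real.exp (-x) - (1 - Real.exp (-1))) :=
      mul_nonneg (by linarith) (by linarith)
    have k4 : y * (1 - Real.exp (-1) + 0.302 * (1 - y)) * (x / y)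
        = (1 - Real.exp (-1) + 0.302 * (1 - y)) * x := by rw [mul_right_comm, exy]; ring
    nlinarith
  · have k1 := mul_le_mul_of_nonneg_right (exp_neg_le_of_half_le h hy1) hxy
    have k2 : 0.25 * x + 2 * Real.exp (-x) ≥ 0.6322 := by
      rcases le_total x 8 with hx' | hx'
      · nlinarith [tangent 2]
      · linarith
    have k3 : 0 ≤ (1 - y) * (0.25 * x + 2 * Real.exp (-x) - (1 - Real.exp (-1))) :=
      mul_nonneg (by linarith) (by linarith)
    have k4 : y * (1 - Real.exp (-1) + 0.25 * (1 - y)) * (x / y)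
        = (1 - Real.exp (-1) + 0.25 * (1 - y)) * x := by rw [mul_right_comm, exy]; ring
    nlinarith

theorem rpow_partition_inequality {s r p : ℝ} (hs : 0 < s) (hsr : s ≤ r) (hr : r ≤ 1)
    (hp : 1 ≤ p) : (1 - r) * p + r ^ p ≤ (1 - s) * p + s ^ p := by
  have hr0 : 0 < r := hs.trans_le hsr
  have b := one_add_mul_self_le_rpow_one_add (s := s / r - 1)
    (by have : 0 < s / r := by positivity
        linarith) hp
  have e : s ^ p = r ^ p * (1 + (s / r - 1)) ^ p := by
    rw [← Real.mul_rpow hr0.le (by have : 0 < s / r := by positivity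
                                   linarith)]
    congr 1; field_simp; ring
  have hrp : 0 < r ^ p := Real.rpow_pos_of_pos hr0 p
  have hrp1 : r ^ p ≤ r := by
    simpa using Real.rpow_le_rpow_of_exponent_ge hr0 hr hp
  rw [e]
  have k1 := mul_le_mul_of_nonneg_left b hrp.le
  have k2 : 0 ≤ 1 - s / r := sub_nonneg.2 ((div_le_one hr0).2 hsr)
  have k3 := mul_le_mul_of_nonneg_right hrp1 (mul_nonneg (by linarith : 0 ≤ p) k2)
  have k4 : r * (p * (1 - s / r)) = p * (r - s) := by field_simp
  nlinarith

theorem one_sub_inv_pow_le_exp {K n : ℕ} (hK : 1 ≤ K) :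
    (1 - 1 / (K : ℝ)) ^ n ≤ Real.exp (-((n : ℝ) / K)) := by
  have hK' : (1 : ℝ) ≤ K := by exact_mod_cast hK
  have h1 : 1 / (K : ℝ) ≤ 1 := (div_le_one (by linarith)).2 hK'
  have := pow_le_pow_left₀ (sub_nonneg.2 h1) (Real.one_sub_le_exp_neg (1 / (K : ℝ))) n
  rw [← Real.exp_nat_mul] at this
  refine this.trans (le_of_eq ?_)
  congr 1; ring

theorem mul_one_sub_exp_neg_one_le {y : ℝ} (h0 : 0 ≤ y) (h1 : y ≤ 1) :
    y * (1 - Real.exp (-1)) ≤ 1 - Real.exp (-y) := by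
  have := mul_nonneg h0 (sub_nonneg.2 h1)
  rcases le_total y (1 / 2) with h | h
  · linarith [exp_neg_le_of_le_half h0 h]
  · linarith [exp_neg_le_of_half_le h h1]

namespace IsCostShare

variable {V : Type*} [DecidableEq V] {f : Finset V → ℝ} {η β : ℝ} {χ : List V → V → ℝ}

theorem const_mul (h : IsCostShare f η β χ) {c : ℝ} (hc : 0 ≤ c) :
    IsCostShare (fun S => c * f S) η β (fun l i => c * χ l i) := by
  refine ⟨fun l hne hl => ?_, fun l hl s hs i hi => ?_, fun l hne hl => ?_⟩
  · obtain ⟨h1, h2⟩ := h.1 l hne hl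
    rw [← Finset.mul_sum, mul_div_assoc]
    exact ⟨mul_le_mul_of_nonneg_left h1 hc, mul_le_mul_of_nonneg_left h2 hc⟩
  · exact mul_le_mul_of_nonneg_left (h.2.1 l hl s hs i hi) hc
  · have := mul_le_mul_of_nonneg_left (h.2.2 l hne hl) hc
    rw [← Finset.mul_sum]
    linarith

theorem sum_le_of_empty_eq_zero_or_card_eq (h : IsCostShare f η β χ)
    (hmono : ∀ S T : Finset V, S ⊆ T → f S ≤ f T) (hf0 : 0 ≤ f ∅) (hη : 1 ≤ η) (hβ : 1 ≤ β)
    {K : ℕ} (hK : 1 ≤ K) (L : List (List V)) (hL : ∀ l ∈ L, l ≠ []) (hn : L.flatten.Nodup)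
    (hsort : L.Pairwise fun l m => f l.toFinset ≤ f m.toFinset) (hLK : L.length ≤ K)
    (hLne : L ≠ []) (hcase : ((K : ℝ) - L.length) * f ∅ = 0) :
    (1 - Real.exp (-1)) * (((L.map fun l => f l.toFinset).sum + (K - L.length) * f ∅) / K)
      ≤ η * β * sublistExp (1 / (K : ℝ)) L.flatten (fun s => f s.toFinset) := by
  have hK' : (1 : ℝ) ≤ K := by exact_mod_cast hK
  have hK0 : (0 : ℝ) < K := by linarith
  have hq0 : 0 ≤ 1 / (K : ℝ) := by positivity
  have hq1 : 1 / (K : ℝ) ≤ 1 := (div_le_one hK0).2 hK'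
  have hnpos : (0 : ℝ) < L.length := by exact_mod_cast List.length_pos_iff.2 hLne
  have hβ0 : 0 < β := by linarith
  have k1 := h.discountedSum_le_sublistExp hmono hβ0 hq0 hq1 L hL [] hn
  have k2 := card_mul_discountedSum_ge hq0 hq1 (L.map fun l => f l.toFinset / β)
    (List.pairwise_map.2 (hsort.imp fun hab => div_le_div_of_nonneg_right hab hβ0.le))
  have k3 := sublistExp_mono hq0 hq1 L.flatten (incrementalCost χ [])
    (fun s => η * f s.toFinset + 0) (fun s hs => by
      rcases eq_or_ne s [] with rfl | hne
      · simpa [incrementalCost] using mul_nonneg (by linarith : 0 ≤ η) hf0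
      · simpa using h.incrementalCost_le hne (hn.sublist hs))
  rw [sublistExp_affine _ η 0 L.flatten (fun s => f s.toFinset)] at k3
  simp only [List.nil_append, incrementalCost, mul_zero, zero_add] at k1
  rw [List.length_map] at k2
  have hsum : (L.map fun l => f l.toFinset / β).sum
      = (L.map fun l => f l.toFinset).sum / β := by
    simp only [div_eq_mul_inv, List.sum_map_mul_right]
  rw [hsum] at k2
  set X := (L.map fun l => f l.toFinset).sum with hX
  have hX0 : 0 ≤ X := List.sum_nonneg (by
    intro x hx
    obtain ⟨l, _, rfl⟩ := List.mem_map.1 hx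
    exact hf0.trans (hmono _ _ (Finset.empty_subset _)))
  have hy1 : (L.length : ℝ) / K ≤ 1 := (div_le_one hK0).2 (by exact_mod_cast hLK)
  have k4 := mul_one_sub_exp_neg_one_le (y := (L.length : ℝ) / K) (by positivity) hy1
  have k5 := one_sub_inv_pow_le_exp (n := L.length) hK
  have k6 : (L.length : ℝ) / K * (1 - Real.exp (-1)) ≤ 1 - (1 - 1 / (K : ℝ)) ^ L.length := by
    linarith
  have k7 := mul_le_mul_of_nonneg_right k6 (div_nonneg hX0 hβ0.le)
  have k8 : (L.length : ℝ) * ((1 - Real.exp (-1)) * (X / K) / β)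
      ≤ L.length * (η * sublistExp (1 / (K : ℝ)) L.flatten (fun s => f s.toFinset)) := by
    refine le_trans (le_of_eq (by ring)) (k7.trans (k2.trans ?_))
    exact mul_le_mul_of_nonneg_left (by linarith) hnpos.le
  have k9 := le_of_mul_le_mul_left k8 hnpos
  rw [div_le_iff₀ hβ0] at k9
  rw [hcase, add_zero]
  linarith

theorem sum_le_of_empty_eq (h : IsCostShare f η β χ)
    (hmono : ∀ S T : Finset V, S ⊆ T → f S ≤ f T) (hf0 : f ∅ = β) (hη : 1 ≤ η) (hβ : 1 ≤ β)
    {K : ℕ} (L : List (List V)) (hL : ∀ l ∈ L, l ≠ []) (hn : L.flatten.Nodup)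
    (hsort : L.Pairwise fun l m => f l.toFinset ≤ f m.toFinset) (hLK : L.length < K)
    (hLne : L ≠ []) :
    (1 - Real.exp (-1)) * (((L.map fun l => f l.toFinset).sum + (K - L.length) * f ∅) / K)
      ≤ η * β * sublistExp (1 / (K : ℝ)) L.flatten (fun s => f s.toFinset) := by
  have hlen : 1 ≤ L.length := List.length_pos_iff.2 hLne
  have hK' : (1 : ℝ) < K := by exact_mod_cast lt_of_le_of_lt hlen hLK
  have hK0 : (0 : ℝ) < K := by linarith
  have hq0 : 0 < 1 / (K : ℝ) := by positivity
  have hq1 : 1 / (K : ℝ) < 1 := (div_lt_one hK0).2 hK'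
  have hnpos : (0 : ℝ) < L.length := by exact_mod_cast hlen
  have hβ0 : 0 < β := by linarith
  have hone : ∀ S, 1 ≤ f S / β := fun S => by
    rw [le_div_iff₀ hβ0, one_mul, ← hf0]
    exact hmono _ _ (Finset.empty_subset _)
  have k1 := h.discountedSum_add_rpow_le_sublistExp hmono hβ0 hone hq0 hq1 L hL hn
  have k2 := card_mul_discountedSum_ge hq0.le hq1.le (L.map fun l => f l.toFinset / β)
    (List.pairwise_map.2 (hsort.imp fun hab => div_le_div_of_nonneg_right hab hβ0.le))
  have k3 := sublistExp_mono hq0.le hq1.le L.flatten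
    (fun s => if s = [] then 1 else incrementalCost χ [] s)
    (fun s => η * f s.toFinset + 0) (fun s hs => by
      rcases eq_or_ne s [] with rfl | hne
      · simp [hf0]; nlinarith
      · simpa [hne] using h.incrementalCost_le hne (hn.sublist hs))
  rw [sublistExp_affine _ η 0 L.flatten (fun s => f s.toFinset)] at k3
  rw [List.length_map] at k2
  have hsum : (L.map fun l => f l.toFinset / β).sum
      = (L.map fun l => f l.toFinset).sum / β := by
    simp only [div_eq_mul_inv, List.sum_map_mul_right]
  have hlow : (L.length : ℝ) ≤ (L.map fun l => f l.toFinset / β).sum := by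
    have := List.card_nsmul_le_sum (L.map fun l => f l.toFinset / β) 1 (by
      intro x hx
      obtain ⟨l, _, rfl⟩ := List.mem_map.1 hx
      exact hone _)
    simpa using this
  rw [hsum] at k1 k2 hlow
  set Y := (L.map fun l => f l.toFinset).sum with hY
  set X := Y / β with hX
  have eY : Y = β * X := by rw [hX]; field_simp
  set n := (L.length : ℝ) with hnn
  have ht : 0 < 1 - 1 / (K : ℝ) := by linarith
  have hy1 : n / K ≤ 1 := (div_le_one hK0).2 (by rw [hnn]; exact_mod_cast hLK.le)
  have r1 := exp_neg_partition_inequality (x := X / K) (y := n / K)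
    (div_nonneg (hnpos.le.trans hlow) hK0.le) (by positivity) hy1
  have r2 := rpow_partition_inequality (p := X / n) (pow_pos ht L.length)
    (one_sub_inv_pow_le_exp (n := L.length) (by exact_mod_cast hK'.le))
    (Real.exp_le_one_iff.2 (by have : 0 < n / K := by positivity
                               linarith))
    ((one_le_div hnpos).2 hlow)
  have e1 : (Real.exp (-(n / K))) ^ (X / n) = Real.exp (-(X / K)) := by
    rw [← Real.exp_mul]; congr 1; field_simp
  have e2 : ((1 - 1 / (K : ℝ)) ^ L.length) ^ (X / n) = (1 - 1 / (K : ℝ)) ^ X := by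
    rw [← Real.rpow_natCast, ← Real.rpow_mul ht.le, ← hnn]; congr 1; field_simp
  have e3 : X / K / (n / K) = X / n := by field_simp
  rw [← hnn, e1, e2] at r2
  rw [e3] at r1
  have k4 : (1 - (1 - 1 / (K : ℝ)) ^ L.length) * (X / n)
      ≤ discountedSum (1 / (K : ℝ)) (L.map fun l => f l.toFinset / β) := by
    rw [← mul_div_assoc, div_le_iff₀ hnpos]
    linarith
  have k5 : (1 - Real.exp (-1)) * (X / K + (1 - n / K))
      ≤ η * sublistExp (1 / (K : ℝ)) L.flatten (fun s => f s.toFinset) := by linarith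
  have k6 := mul_le_mul_of_nonneg_left k5 hβ0.le
  have e4 : (Y + (K - n) * f ∅) / K = β * (X / K + (1 - n / K)) := by
    rw [eY, hf0]; field_simp
  rw [e4]
  linarith

theorem sum_le_sublistExp (h : IsCostShare f η β χ)
    (hmono : ∀ S T : Finset V, S ⊆ T → f S ≤ f T) (hf0 : 0 ≤ f ∅) (hη : 1 ≤ η) (hβ : 1 ≤ β)
    {K : ℕ} (hK : 1 ≤ K) (L : List (List V)) (hL : ∀ l ∈ L, l ≠ []) (hn : L.flatten.Nodup)
    (hsort : L.Pairwise fun l m => f l.toFinset ≤ f m.toFinset) (hLK : L.length ≤ K) :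
    (1 - Real.exp (-1)) * (((L.map fun l => f l.toFinset).sum + (K - L.length) * f ∅) / K)
      ≤ η * β * sublistExp (1 / (K : ℝ)) L.flatten (fun s => f s.toFinset) := by
  rcases eq_or_ne L [] with rfl | hLne
  · have hK0 : (K : ℝ) ≠ 0 := by positivity
    have := mul_nonneg (Real.exp_pos (-1)).le hf0
    have hηβ : 1 ≤ η * β := one_le_mul_of_one_le_of_one_le hη hβ
    have := mul_le_mul_of_nonneg_right hηβ hf0
    simp only [List.map_nil, List.sum_nil, List.length_nil, List.flatten_nil, sublistExp,
      List.toFinset_nil, Nat.cast_zero, sub_zero, zero_add]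
    rw [mul_div_cancel_left₀ _ hK0]
    linarith
  by_cases hcase : ((K : ℝ) - L.length) * f ∅ = 0
  · exact h.sum_le_of_empty_eq_zero_or_card_eq hmono hf0 hη hβ hK L hL hn hsort hLK hLne hcase
  obtain ⟨h1, h2⟩ := mul_ne_zero_iff.1 hcase
  have hc : 0 < f ∅ := lt_of_le_of_ne hf0 (Ne.symm h2)
  have hlt : L.length < K := lt_of_le_of_ne hLK (fun e => h1 (by rw [e]; ring))
  have hs : 0 < β / f ∅ := by positivity
  have key := (h.const_mul hs.le).sum_le_of_empty_eq
    (fun S T hST => mul_le_mul_of_nonneg_left (hmono S T hST) hs.le)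
    (by field_simp) hη hβ (K := K) L hL hn
    (hsort.imp fun hab => mul_le_mul_of_nonneg_left hab hs.le) hlt hLne
  have e := sublistExp_affine (1 / (K : ℝ)) (β / f ∅) 0 L.flatten (fun s => f s.toFinset)
  simp only [add_zero] at e
  rw [e, List.sum_map_mul_left] at key
  refine le_of_mul_le_mul_left (le_trans (le_of_eq ?_) (key.trans (le_of_eq ?_))) hs <;> ring

end IsCostShare

/-- A finite partition into possibly empty parts, listed as duplicate-free nonempty lists in
increasing order of the value of `f`. -/
theorem exists_sorted_parts {V : Type*} [Fintype V] [DecidableEq V] (K : ℕ)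
    (f : Finset V → ℝ) (A : Fin K → Finset V)
    (hdisj : ∀ k l : Fin K, k ≠ l → Disjoint (A k) (A l))
    (hcover : Finset.univ.biUnion A = Finset.univ) :
    ∃ L : List (List V), (∀ l ∈ L, l ≠ []) ∧ L.flatten.Nodup ∧
      L.flatten.toFinset = Finset.univ ∧
      (L.Pairwise fun l m => f l.toFinset ≤ f m.toFinset) ∧ L.length ≤ K ∧
      ∑ k, f (A k) = (L.map fun l => f l.toFinset).sum + (K - L.length) * f ∅ := by
  set I : List (Fin K) := (List.finRange K).filter (fun k => A k ≠ ∅) with hI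
  have hInd : I.Nodup := (List.nodup_finRange K).filter _
  have hImem (k : Fin K) : k ∈ I ↔ A k ≠ ∅ := by simp [hI]
  set r : Fin K → Fin K → Prop := fun k l => f (A k) ≤ f (A l) with hr
  have : Std.Total r := ⟨fun _ _ => le_total _ _⟩
  have : IsTrans (Fin K) r := ⟨fun _ _ _ => le_trans⟩
  classical
  set J := I.insertionSort r with hJ
  have hperm : J.Perm I := List.perm_insertionSort r I
  have hJnd : J.Nodup := hperm.nodup_iff.2 hInd
  have hJmem (k : Fin K) : k ∈ J ↔ A k ≠ ∅ := by rw [hperm.mem_iff, hImem]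
  have hJset : J.toFinset = Finset.univ.filter (fun k => A k ≠ ∅) := by ext k; simp [hJmem]
  have hlen : J.length = #(Finset.univ.filter (fun k => A k ≠ ∅)) := by
    rw [← hJset, List.toFinset_card_of_nodup hJnd]
  refine ⟨J.map fun k => (A k).toList, ?_, ?_, ?_, ?_, ?_, ?_⟩
  · simp [hJmem]
  · rw [List.nodup_flatten]
    refine ⟨by simp [Finset.nodup_toList], ?_⟩
    rw [List.pairwise_map]
    refine hJnd.imp fun {k l} hkl => ?_
    intro x hx hx'
    exact Finset.disjoint_left.1 (hdisj k l hkl) (by simpa using hx) (by simpa using hx')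
  · refine Finset.eq_univ_iff_forall.2 fun x => ?_
    have hx : x ∈ Finset.univ.biUnion A := by rw [hcover]; simp
    obtain ⟨k, _, hk⟩ := Finset.mem_biUnion.1 hx
    have : A k ≠ ∅ := Finset.ne_empty_of_mem hk
    simp only [List.mem_toFinset, List.mem_flatten, List.mem_map]
    exact ⟨_, ⟨k, (hJmem k).2 this, rfl⟩, by simpa using hk⟩
  · rw [List.pairwise_map]
    simpa using List.pairwise_insertionSort r I
  · rw [List.length_map, hlen]
    simpa using Finset.card_filter_le (Finset.univ : Finset (Fin K)) (fun k => A k ≠ ∅)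
  · rw [List.length_map, List.map_map]
    have e1 : (J.map ((fun l : List V => f l.toFinset) ∘ fun k => (A k).toList)).sum
        = ∑ k ∈ Finset.univ.filter (fun k => A k ≠ ∅), f (A k) := by
      rw [← hJset, List.sum_toFinset _ hJnd]
      simp [Function.comp_def]
    have e2 : ∑ k ∈ Finset.univ.filter (fun k => ¬ A k ≠ ∅), f (A k)
        = #(Finset.univ.filter (fun k => ¬ A k ≠ ∅)) * f ∅ := by
      rw [← nsmul_eq_mul, ← Finset.sum_const]
      refine Finset.sum_congr rfl fun k hk => ?_
      rw [not_not.1 (Finset.mem_filter.1 hk).2]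
    have e3 := Finset.card_filter_add_card_filter_not (s := (Finset.univ : Finset (Fin K)))
      (fun k => A k ≠ ∅)
    rw [Finset.card_univ, Fintype.card_fin] at e3
    have e4 : (#(Finset.univ.filter (fun k => ¬ A k ≠ ∅)) : ℝ) = K - J.length := by
      rw [hlen, eq_sub_iff_add_eq, add_comm]
      exact_mod_cast e3
    rw [← Finset.sum_filter_add_sum_filter_not Finset.univ (fun k => A k ≠ ∅), e1, e2, e4]

/-- Lemma 1: if `f` is non-decreasing with an `(η,β)`-cost-sharing scheme and
`A_1, …, A_K` is a partition of the ground set into K (possibly empty) parts, then the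
expected value of the K-partition-type distribution, `(1/K)·Σ_k f(A_k)`, is at most
`η·β·(e/(e-1))` times the expected value of `f` under the independent distribution with
marginals `1/K`.  In particular, for instances whose worst-case distribution is of
K-partition type, the correlation gap `L/I` is at most `ηβ·e/(e-1)`. -/
theorem partition_type_correlation_gap
    {V : Type*} [Fintype V] [DecidableEq V]
    (K : ℕ) (hK : 1 ≤ K)
    (f : Finset V → ℝ)
    (hmono : ∀ S T : Finset V, S ⊆ T → f S ≤ f T)
    (hf0 : 0 ≤ f ∅)
    (η β : ℝ) (hη : 1 ≤ η) (hβ : 1 ≤ β)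
    (χ : List V → V → ℝ) (hχ : IsCostShare f η β χ)
    (A : Fin K → Finset V)
    (hdisj : ∀ k l : Fin K, k ≠ l → Disjoint (A k) (A l))
    (hcover : Finset.univ.biUnion A = Finset.univ) :
    (1 / (K : ℝ)) * ∑ k : Fin K, f (A k)
      ≤ η * β * (Real.exp 1 / (Real.exp 1 - 1))
          * indepVal (fun _ : V => 1 / (K : ℝ)) f := by
  obtain ⟨L, hL, hn, hu, hsort, hLK, hsum⟩ := exists_sorted_parts K f A hdisj hcover
  have key := hχ.sum_le_sublistExp hmono hf0 hη hβ hK L hL hn hsort hLK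
  rw [← hsum, ← indepVal_const_s5 _ _ hn hu] at key
  have he : 0 < Real.exp 1 - 1 := by linarith [Real.exp_one_gt_two]
  have he' : 1 - Real.exp (-1) = (Real.exp 1 - 1) / Real.exp 1 := by
    rw [Real.exp_neg]; field_simp
  rw [he', div_mul_eq_mul_div, div_le_iff₀ (Real.exp_pos 1)] at key
  have e : η * β * (Real.exp 1 / (Real.exp 1 - 1)) * indepVal (fun _ : V => 1 / (K : ℝ)) f
      = η * β * indepVal (fun _ : V => 1 / (K : ℝ)) f * Real.exp 1 / (Real.exp 1 - 1) := by
    ring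
  rw [e, le_div_iff₀ he]
  refine le_trans (le_of_eq (by ring)) key
end
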